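/- Let f : X → Y be a perfect surjection of countable functional weight between paracompact Hausdorff spaces with dim f ≤ n and dim Y ≤ m. Then there exists a set B, dense and G_δ in C(X, I^{2n+1+m}) with the source limitation topology, such that for every g ∈ B the map f × g is an embedding of X into Y × I^{2n+1+m}, and moreover g satisfies: dim (g(f⁻¹(y)) ∩ Π) ≤ k − n − 1 for every y ∈ Y and every rational k-plane Π in R^{2n+1+m} with 0 ≤ k ≤ 2n. -/

import Mathlib

open Set Topology

noncomputable section

/-- The `k`-dimensional cube `I^k`, viewed inside Euclidean space with the Euclidean metric. -/
def cube (k : ℕ) : Set (EuclideanSpace ℝ (Fin k)) := {x | ∀ i, x i ∈ Set.Icc (0:ℝ) 1}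

/-- The Hilbert cube `I^∞`, embedded in `ℓ²` as a closed convex subset; its metric `d_∞` is the
one induced by the `ℓ²` norm. -/
def HilbertCube : Set (lp (fun _ : ℕ => ℝ) 2) :=
  {x | ∀ i : ℕ, (x : ℕ → ℝ) i ∈ Set.Icc (0:ℝ) (1 / 2 ^ i)}

/-- Covering dimension of a topological space is at most `n` (as an integer, so that `n ≤ -1`
means the space is empty): every finite open cover admits an open shrinking of order `≤ n + 1`. -/
def CovDimLE (X : Type*) [TopologicalSpace X] (n : ℤ) : Prop :=
  ∀ (ι : Type) (U : ι → Set X), Finite ι → (∀ i, IsOpen (U i)) → (⋃ i, U i) = Set.univ →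
    ∃ V : ι → Set X, (∀ i, IsOpen (V i)) ∧ (∀ i, V i ⊆ U i) ∧ (⋃ i, V i) = Set.univ ∧
      ∀ x : X, (({i | x ∈ V i}).ncard : ℤ) ≤ n + 1

/-- A perfect map: continuous, closed, with compact fibers. -/
def IsPerfectMap {X Y : Type*} [TopologicalSpace X] [TopologicalSpace Y] (f : X → Y) : Prop :=
  Continuous f ∧ IsClosedMap f ∧ ∀ y : Y, IsCompact (f ⁻¹' {y})

/-- `f` has countable (functional) weight: there is a continuous `h : X → I^∞` such that the
diagonal product `f × h` embeds `X` into `Y × I^∞`. -/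
def HasCountableFunctionalWeight {X Y : Type*} [TopologicalSpace X] [TopologicalSpace Y]
    (f : X → Y) : Prop :=
  ∃ h : C(X, ↥HilbertCube), IsEmbedding (fun x => (f x, h x) : X → Y × ↥HilbertCube)

/-- `h` restricted to `A` is an `ω`-map: every point of `A` has a neighborhood `V` of its image
whose preimage within `A` is contained in some member of `ω`. -/
def IsOmegaMapOn {X Z : Type*} [TopologicalSpace X] [TopologicalSpace Z]
    (ω : Set (Set X)) (h : X → Z) (A : Set X) : Prop :=
  ∀ x ∈ A, ∃ V ∈ nhds (h x), ∃ W ∈ ω, A ∩ h ⁻¹' V ⊆ W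

/-- A set `U ⊆ C(X, M)` is open in the source limitation (fine) topology: every `g ∈ U` admits a
continuous `α : X → (0, ∞)` with `B̄(g, α) ⊆ U`. -/
def SLOpen {X M : Type*} [TopologicalSpace X] [PseudoMetricSpace M] (U : Set C(X, M)) : Prop :=
  ∀ g ∈ U, ∃ α : C(X, ℝ), (∀ x, 0 < α x) ∧
    {h : C(X, M) | ∀ x, dist (g x) (h x) ≤ α x} ⊆ U

/-- A set `D ⊆ C(X, M)` is dense in the source limitation topology. -/
def SLDense {X M : Type*} [TopologicalSpace X] [PseudoMetricSpace M] (D : Set C(X, M)) : Prop :=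
  ∀ U : Set C(X, M), SLOpen U → U.Nonempty → (U ∩ D).Nonempty

/-- A set `D ⊆ C(X, M)` is a `G_δ`-set in the source limitation topology. -/
def SLGdelta {X M : Type*} [TopologicalSpace X] [PseudoMetricSpace M] (D : Set C(X, M)) : Prop :=
  ∃ F : ℕ → Set C(X, M), (∀ i, SLOpen (F i)) ∧ D = ⋂ i, F i

/-- `Y` is a `C`-space: for every sequence `ω` of open covers there are pairwise disjoint open
families `γ i`, with `γ i` refining `ω i`, whose union covers `Y`. -/
def IsCSpace (Y : Type*) [TopologicalSpace Y] : Prop :=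
  ∀ ω : ℕ → Set (Set Y), (∀ i, ∀ U ∈ ω i, IsOpen U) → (∀ i, ⋃₀ ω i = Set.univ) →
    ∃ γ : ℕ → Set (Set Y),
      (∀ i, ∀ U ∈ γ i, IsOpen U) ∧
      (∀ i, (γ i).Pairwise Disjoint) ∧
      (∀ i, ∀ U ∈ γ i, ∃ W ∈ ω i, U ⊆ W) ∧
      ⋃₀ (⋃ i, γ i) = Set.univ

/-- A closed set `F` in a metric space `M` is a `Z_m`-set: the maps `I^m → M` avoiding `F` are
dense in the space of maps `I^m → M` with the uniform convergence (sup-metric) topology. -/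
def IsZSet {M : Type*} [PseudoMetricSpace M] (m : ℕ) (F : Set M) : Prop :=
  IsClosed F ∧ Dense {u : BoundedContinuousFunction ↥(cube m) M | ∀ z, u z ∉ F}

/-- A `σZ_m`-set: a countable union of closed `Z_m`-sets. -/
def IsSigmaZSet {M : Type*} [PseudoMetricSpace M] (m : ℕ) (S : Set M) : Prop :=
  ∃ F : ℕ → Set M, (∀ i, IsZSet m (F i)) ∧ S = ⋃ i, F i

/-- A `k`-plane in `ℝ^p`: the set where `p - k` fixed coordinates take fixed real values. -/
def IsPlane (p k : ℕ) (P : Set (EuclideanSpace ℝ (Fin p))) : Prop :=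
  ∃ (s : Finset (Fin p)) (r : Fin p → ℝ), s.card = p - k ∧
    P = {x | ∀ i ∈ s, x i = r i}

/-- A rational `k`-plane in `ℝ^p`: the fixed coordinate values are rational. -/
def IsRatPlane (p k : ℕ) (P : Set (EuclideanSpace ℝ (Fin p))) : Prop :=
  ∃ (s : Finset (Fin p)) (r : Fin p → ℚ), s.card = p - k ∧
    P = {x | ∀ i ∈ s, x i = (r i : ℝ)}

/-- Condition (R): `dim (g(f⁻¹(y)) ∩ Π) ≤ k - n - 1` for every `y ∈ Y` and every rational
`k`-plane `Π` in `ℝ^{2n+1+m}` with `0 ≤ k ≤ 2n`. -/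
def ConditionR {X Y : Type*} [TopologicalSpace X] [TopologicalSpace Y]
    (f : X → Y) (n m : ℕ) (g : X → ↥(cube (2*n+1+m))) : Prop :=
  ∀ y : Y, ∀ k : ℕ, k ≤ 2*n → ∀ P : Set (EuclideanSpace ℝ (Fin (2*n+1+m))),
    IsRatPlane (2*n+1+m) k P →
    CovDimLE ↥(((fun x => ((g x : EuclideanSpace ℝ (Fin (2*n+1+m))))) '' (f ⁻¹' {y})) ∩ P)
      ((k : ℤ) - n - 1)

/-- The restriction `f|B` is σ-perfect with countable weight: `B = ⋃ᵢ Bᵢ` with `Bᵢ ⊆ X` closed,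
`f(Bᵢ) ⊆ Y` closed, and each `f|Bᵢ : Bᵢ → f(Bᵢ)` a perfect map of countable weight. -/
def SigmaPerfectCW {X Y : Type*} [TopologicalSpace X] [TopologicalSpace Y]
    (f : X → Y) (B : Set X) : Prop :=
  ∃ Bi : ℕ → Set X, B = ⋃ i, Bi i ∧ ∀ i : ℕ,
    IsClosed (Bi i) ∧ IsClosed (f '' Bi i) ∧
    IsPerfectMap ((Set.mapsTo_image f (Bi i)).restrict f (Bi i) (f '' Bi i)) ∧
    HasCountableFunctionalWeight ((Set.mapsTo_image f (Bi i)).restrict f (Bi i) (f '' Bi i))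

/-- ball-density: every `g` can be approximated within any positive continuous function. -/
def BallDense {X M : Type*} [TopologicalSpace X] [PseudoMetricSpace M] (D : Set C(X, M)) : Prop :=
  ∀ (g : C(X, M)) (α : C(X, ℝ)), (∀ x, 0 < α x) → ∃ g' ∈ D, ∀ x, dist (g x) (g' x) ≤ α x

theorem baire_SL {X M : Type*} [TopologicalSpace X] [MetricSpace M] [CompleteSpace M]
    (F : ℕ → Set C(X, M)) (ho : ∀ i, SLOpen (F i)) (hd : ∀ i, BallDense (F i)) :
    SLDense (⋂ i, F i) := by
  intro U hU ⟨g0, hg0⟩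
  obtain ⟨α0, hα0, hα0U⟩ := hU g0 hg0
  have step : ∀ (k : ℕ) (s : C(X, M) × {a : C(X, ℝ) // ∀ x, 0 < a x}),
      ∃ s' : C(X, M) × {a : C(X, ℝ) // ∀ x, 0 < a x},
        (∀ x, dist (s.1 x) (s'.1 x) ≤ s.2.1 x / 2) ∧ (∀ x, s'.2.1 x ≤ s.2.1 x / 2) ∧
        {h : C(X, M) | ∀ x, dist (s'.1 x) (h x) ≤ s'.2.1 x} ⊆ F k := by
    rintro k ⟨g, α, hα⟩
    obtain ⟨g', hg', hgg'⟩ := hd k g ⟨fun x => α x / 2, by fun_prop⟩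
      (fun x => by have := hα x; simp; linarith)
    obtain ⟨β, hβ, hβF⟩ := ho k g' hg'
    refine ⟨⟨g', ⟨⟨fun x => min (α x / 2) (β x), by fun_prop⟩, fun x => ?_⟩⟩, ?_, ?_, ?_⟩
    · have := hα x; have := hβ x; simp; constructor <;> linarith
    · intro x; exact hgg' x
    · intro x; simp
    · intro h hh
      apply hβF
      intro x
      exact (hh x).trans (by simp)
  choose nxt hn1 hn2 hn3 using step
  let s0 : C(X, M) × {a : C(X, ℝ) // ∀ x, 0 < a x} :=
    ⟨g0, ⟨⟨fun x => min (α0 x) 1, by fun_prop⟩, fun x => by have := hα0 x; simp [this]⟩⟩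
  let s : ℕ → C(X, M) × {a : C(X, ℝ) // ∀ x, 0 < a x} := fun k => Nat.rec s0 (fun k s => nxt k s) k
  have hs : ∀ k, s (k+1) = nxt k (s k) := fun k => rfl
  have hd1 : ∀ k x, dist ((s k).1 x) ((s (k+1)).1 x) ≤ (s k).2.1 x / 2 := fun k x => by
    rw [hs]; exact hn1 k (s k) x
  have ha1 : ∀ k x, (s (k+1)).2.1 x ≤ (s k).2.1 x / 2 := fun k x => by
    rw [hs]; exact hn2 k (s k) x
  have hpos : ∀ k x, 0 < (s k).2.1 x := fun k x => (s k).2.2 x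
  have hF : ∀ k, {h : C(X, M) | ∀ x, dist ((s (k+1)).1 x) (h x) ≤ (s (k+1)).2.1 x} ⊆ F k := by
    intro k; rw [hs]; exact hn3 k (s k)
  have htel : ∀ x k j, dist ((s k).1 x) ((s (k+j)).1 x) ≤ (s k).2.1 x - (s (k+j)).2.1 x := by
    intro x k j
    induction j with
    | zero => simp
    | succ j ih =>
      have := dist_triangle ((s k).1 x) ((s (k+j)).1 x) ((s (k+j+1)).1 x)
      have h1 := hd1 (k+j) x
      have h2 := ha1 (k+j) x
      rw [← add_assoc]
      linarith
  have hle : ∀ k x, (s k).2.1 x ≤ (1/2)^k := by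
    intro k x
    induction k with
    | zero => simp [s, s0]
    | succ k ih => have := ha1 k x; rw [pow_succ]; linarith
  have hcau : ∀ x, CauchySeq (fun k => (s k).1 x) := by
    intro x
    apply cauchySeq_of_le_geometric (1/2) 1 (by norm_num)
    intro k
    have := hd1 k x
    have := hle k x
    have := hpos k x
    linarith
  choose L hL using fun x => cauchySeq_tendsto_of_complete (hcau x)
  have hlim : ∀ k x, dist ((s k).1 x) (L x) ≤ (s k).2.1 x := by
    intro k x
    have : Filter.Tendsto (fun j => dist ((s k).1 x) ((s (k+j)).1 x)) Filter.atTop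
        (𝓝 (dist ((s k).1 x) (L x))) := by
      apply Filter.Tendsto.dist tendsto_const_nhds
      have := (Filter.tendsto_add_atTop_iff_nat (f := fun k => (s k).1 x) k).2 (hL x)
      simpa [add_comm] using this
    apply le_of_tendsto this
    filter_upwards with j
    have := htel x k j
    have := hpos (k+j) x
    linarith
  have hcont : Continuous L := by
    have hu : TendstoUniformly (fun k x => (s k).1 x) L Filter.atTop := by
      rw [Metric.tendstoUniformly_iff]
      intro ε hε
      have : Filter.Tendsto (fun k : ℕ => ((1:ℝ)/2)^k) Filter.atTop (𝓝 0) :=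
        tendsto_pow_atTop_nhds_zero_of_lt_one (by norm_num) (by norm_num)
      filter_upwards [this.eventually (gt_mem_nhds hε)] with k hk x
      rw [dist_comm]
      exact (hlim k x).trans_lt ((hle k x).trans_lt hk)
    exact hu.continuous (Filter.Eventually.of_forall fun k => (s k).1.continuous).frequently
  refine ⟨⟨L, hcont⟩, hα0U ?_, ?_⟩
  · intro x
    refine (hlim 0 x).trans ?_
    simp [s, s0]
  · rw [mem_iInter]
    intro k
    exact hF k (fun x => hlim (k+1) x)

theorem coloring {Y κ : Type*} [TopologicalSpace Y] [T2Space Y] [ParacompactSpace Y]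
    (V : κ → Set Y) (hV : ∀ k, IsOpen (V k)) (hc : ⋃ k, V k = univ) :
    ∃ (G : ℕ → Set Y) (S : ℕ → Y → Finset κ), (∀ i, IsOpen (G i)) ∧ (⋃ i, G i = univ) ∧
      (∀ i, ∀ y ∈ G i, (S i y).card = i + 1 ∧ ∀ k ∈ S i y, y ∈ V k) ∧
      (∀ i, ∀ y ∈ G i, ∀ᶠ y' in 𝓝 y, S i y' = S i y) := by
  classical
  obtain ⟨φ, hφ⟩ := PartitionOfUnity.exists_isSubordinate isClosed_univ V hV (by rw [hc])
  let Q : Finset κ → Y → Prop := fun S y =>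
    (∀ j ∈ S, 0 < φ j y) ∧ ∀ j ∈ S, ∀ i, i ∉ S → φ i y < φ j y
  have huniq : ∀ S S' y, Q S y → Q S' y → S.card = S'.card → S = S' := by
    intro S S' y h h' hcard
    by_contra hne
    have h1 : ¬ S ⊆ S' := fun hs => hne (Finset.eq_of_subset_of_card_le hs hcard.ge)
    have h2 : ¬ S' ⊆ S := fun hs => hne (Finset.eq_of_subset_of_card_le hs hcard.le).symm
    obtain ⟨a, ha, ha'⟩ := Finset.not_subset.1 h1
    obtain ⟨b, hb, hb'⟩ := Finset.not_subset.1 h2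
    have := h.2 a ha b hb'
    have := h'.2 b hb a ha'
    linarith
  have hopen : ∀ S y, Q S y → ∀ᶠ y' in 𝓝 y, Q S y' := by
    intro S y h
    have hsub := φ.eventually_finsupport_subset y
    have e1 : ∀ᶠ y' in 𝓝 y, ∀ j ∈ S, 0 < φ j y' := by
      rw [Filter.eventually_all_finset]
      intro j hj
      exact (φ j).continuous.continuousAt.eventually (lt_mem_nhds (h.1 j hj))
    have e2 : ∀ᶠ y' in 𝓝 y, ∀ j ∈ S, ∀ i ∈ φ.fintsupport y, i ∉ S → φ i y' < φ j y' := by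
      rw [Filter.eventually_all_finset]
      intro j hj
      rw [Filter.eventually_all_finset]
      intro i _
      by_cases hi : i ∈ S
      · simp [hi]
      · simp only [hi, not_false_eq_true, true_imp_iff]
        exact ContinuousAt.eventually_lt (φ i).continuous.continuousAt
          (φ j).continuous.continuousAt (h.2 j hj i hi)
    filter_upwards [hsub, e1, e2] with y' h1 h2 h3
    refine ⟨h2, fun j hj i hi => ?_⟩
    by_cases hi' : i ∈ φ.finsupport y'
    · exact h3 j hj i (h1 hi') hi
    · rw [φ.mem_finsupport, Function.mem_support, not_not] at hi'
      rw [hi']; exact h2 j hj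
  let G : ℕ → Set Y := fun i => {y | ∃ S : Finset κ, S.card = i + 1 ∧ Q S y}
  let S : ℕ → Y → Finset κ := fun i y => if h : ∃ S : Finset κ, S.card = i + 1 ∧ Q S y then h.choose
    else ∅
  have hS : ∀ i, ∀ y ∈ G i, (S i y).card = i + 1 ∧ Q (S i y) y := by
    intro i y hy
    have hy' : ∃ S : Finset κ, S.card = i + 1 ∧ Q S y := hy
    simp only [S, dif_pos hy']
    exact hy'.choose_spec
  refine ⟨G, S, ?_, ?_, ?_, ?_⟩
  · intro i
    rw [isOpen_iff_mem_nhds]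
    rintro y ⟨T, hT, hQ⟩
    filter_upwards [hopen T y hQ] with y' h'
    exact ⟨T, hT, h'⟩
  · rw [eq_univ_iff_forall]
    intro y
    rw [mem_iUnion]
    obtain ⟨k, hk⟩ := φ.exists_pos (mem_univ y)
    have hk' : k ∈ φ.finsupport y := by rw [φ.mem_finsupport]; exact hk.ne'
    refine ⟨(φ.finsupport y).card - 1, φ.finsupport y, ?_, ?_, ?_⟩
    · have := Finset.card_pos.2 ⟨k, hk'⟩; omega
    · intro j hj
      rw [φ.mem_finsupport, Function.mem_support] at hj
      exact lt_of_le_of_ne (φ.nonneg j y) (Ne.symm hj)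
    · intro j hj i hi
      rw [φ.mem_finsupport, Function.mem_support] at hj
      rw [φ.mem_finsupport, Function.mem_support, not_not] at hi
      rw [hi]
      exact lt_of_le_of_ne (φ.nonneg j y) (Ne.symm hj)
  · intro i y hy
    refine ⟨(hS i y hy).1, fun k hk => ?_⟩
    apply hφ k
    apply subset_tsupport
    exact ((hS i y hy).2.1 k hk).ne'
  · intro i y hy
    filter_upwards [hopen _ y (hS i y hy).2] with y' h'
    have hy' : y' ∈ G i := ⟨_, (hS i y hy).1, h'⟩
    exact huniq _ _ y' (hS i y' hy').2 h' ((hS i y' hy').1.trans (hS i y hy).1.symm)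

theorem dowker_step {κ : Type} {Z : Type*} [TopologicalSpace Z] {m : ℕ} (hdim : CovDimLE Z m)
    (W : κ → Set Z) (hW : ∀ k, IsOpen (W k)) (hc : ⋃ k, W k = univ) (F : Set Z) (hF : IsClosed F)
    (hfin : {k | (W k ∩ F).Nonempty}.Finite) :
    ∃ W' : κ → Set Z, (∀ k, IsOpen (W' k)) ∧ (⋃ k, W' k = univ) ∧ (∀ k, W' k ⊆ W k) ∧
      (∀ y ∈ F, {k | y ∈ W' k}.ncard ≤ m + 1) ∧ (∀ k, W k ∩ F = ∅ → W' k = W k) := by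
  classical
  let K : Set κ := {k | (W k ∩ F).Nonempty}
  have : Finite K := hfin
  let U : Option K → Set Z := fun o => o.elim Fᶜ (fun k => W k.1)
  obtain ⟨V, hVo, hVU, hVc, hVn⟩ := hdim (Option K) U inferInstance
    (by rintro (_ | k); exacts [hF.isOpen_compl, hW _])
    (by
      rw [eq_univ_iff_forall]; intro y
      rw [mem_iUnion]
      by_cases hy : y ∈ F
      · obtain ⟨k, hk⟩ := mem_iUnion.1 (hc ▸ mem_univ y)
        exact ⟨some ⟨k, ⟨y, hk, hy⟩⟩, hk⟩
      · exact ⟨none, hy⟩)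
  refine ⟨fun k => (if h : k ∈ K then V (some ⟨k, h⟩) else ∅) ∪ (W k \ F), ?_, ?_, ?_, ?_, ?_⟩
  · intro k
    apply IsOpen.union
    · split_ifs
      exacts [hVo _, isOpen_empty]
    · exact (hW k).sdiff hF
  · rw [eq_univ_iff_forall]; intro y
    rw [mem_iUnion]
    by_cases hy : y ∈ F
    · obtain ⟨o, ho⟩ := mem_iUnion.1 (hVc ▸ mem_univ y)
      rcases o with _ | k
      · exact absurd hy (hVU none ho)
      · refine ⟨k.1, Or.inl ?_⟩
        rw [dif_pos k.2]; exact ho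
    · obtain ⟨k, hk⟩ := mem_iUnion.1 (hc ▸ mem_univ y)
      exact ⟨k, Or.inr ⟨hk, hy⟩⟩
  · intro k
    apply union_subset _ sdiff_subset
    split_ifs with h
    · exact hVU (some ⟨k, h⟩)
    · exact empty_subset _
  · intro y hy
    have h1 := hVn y
    have h3 : {k | y ∈ (if h : k ∈ K then V (some ⟨k, h⟩) else ∅) ∪ (W k \ F)}.ncard ≤
        {i | y ∈ V i}.ncard := by
      refine Set.ncard_le_ncard_of_injOn
        (fun k => if h : k ∈ K then some (⟨k, h⟩ : K) else none) ?_ ?_ (Set.toFinite _)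
      · rintro k (hk | hk)
        · split_ifs at hk with h
          · simpa [h] using hk
          · exact hk.elim
        · exact absurd hy hk.2
      · rintro k (hk | hk) k' (hk' | hk') heq
        · split_ifs at hk with h
          · split_ifs at hk' with h'
            · simpa [h, h'] using heq
            · exact hk'.elim
          · exact hk.elim
        · exact absurd hy hk'.2
        · exact absurd hy hk.2
        · exact absurd hy hk.2
    have : ({i | y ∈ V i}.ncard : ℤ) ≤ m + 1 := h1
    show {k | y ∈ (if h : k ∈ K then V (some ⟨k, h⟩) else ∅) ∪ (W k \ F)}.ncard ≤ m + 1
    omega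
  · intro k hk
    have hkK : k ∉ K := by
      show ¬ (W k ∩ F).Nonempty
      rw [hk]; exact not_nonempty_empty
    show (if h : k ∈ K then V (some ⟨k, h⟩) else ∅) ∪ (W k \ F) = W k
    rw [dif_neg hkK, empty_union]
    exact (disjoint_iff_inter_eq_empty.2 hk).sdiff_eq_left

theorem dowker_count {κ : Type} {Z : Type*} [TopologicalSpace Z] {m : ℕ} (hdim : CovDimLE Z m)
    (W : κ → Set Z) (hW : ∀ k, IsOpen (W k)) (hc : ⋃ k, W k = univ) (F : ℕ → Set Z)
    (hF : ∀ a, IsClosed (F a)) (hFc : ⋃ a, F a = univ)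
    (hfin : ∀ a, {k | (W k ∩ F a).Nonempty}.Finite)
    (hfin2 : ∀ k, ∃ A, ∀ a ≥ A, W k ∩ F a = ∅) :
    ∃ H : κ → Set Z, (∀ k, IsOpen (H k)) ∧ (⋃ k, H k = univ) ∧ (∀ k, H k ⊆ W k) ∧
      (∀ y, {k | y ∈ H k}.Finite ∧ {k | y ∈ H k}.ncard ≤ m + 1) := by
  classical
  let St := {V : κ → Set Z // (∀ k, IsOpen (V k)) ∧ (⋃ k, V k = univ) ∧ (∀ k, V k ⊆ W k)}
  have step : ∀ (a : ℕ) (V : St), ∃ V' : St, (∀ k, V'.1 k ⊆ V.1 k) ∧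
      (∀ y ∈ F a, {k | y ∈ V'.1 k}.ncard ≤ m + 1) ∧ (∀ k, V.1 k ∩ F a = ∅ → V'.1 k = V.1 k) := by
    rintro a ⟨V, h1, h2, h3⟩
    obtain ⟨V', a1, a2, a3, a4, a5⟩ := dowker_step hdim V h1 h2 (F a) (hF a)
      ((hfin a).subset fun k hk => hk.mono (inter_subset_inter_left _ (h3 k)))
    exact ⟨⟨V', a1, a2, fun k => (a3 k).trans (h3 k)⟩, a3, a4, a5⟩
  choose nxt n1 n2 n3 using step
  let s : ℕ → St := fun a => Nat.rec ⟨W, hW, hc, fun k => subset_rfl⟩ (fun a V => nxt a V) a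
  have hs : ∀ a, s (a+1) = nxt a (s a) := fun a => rfl
  have hanti : ∀ k, Antitone (fun a => (s a).1 k) := by
    intro k
    apply antitone_nat_of_succ_le
    intro a
    show (s (a+1)).1 k ⊆ (s a).1 k
    rw [hs]; exact n1 _ _ _
  choose A hA using hfin2
  have hconst : ∀ k, ∀ a, A k ≤ a → (s a).1 k = (s (A k)).1 k := by
    intro k a ha
    induction a, ha using Nat.le_induction with
    | base => rfl
    | succ a ha ih =>
      rw [← ih, hs]
      apply n3
      apply subset_eq_empty _ (hA k a ha)
      exact inter_subset_inter_left _ ((s a).2.2.2 k)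
  have hsub : ∀ k a, (s (A k)).1 k ⊆ (s a).1 k := by
    intro k a
    rcases le_total a (A k) with h | h
    · exact hanti k h
    · rw [hconst k a h]
  have hfy : ∀ y, {k | y ∈ W k}.Finite := by
    intro y
    obtain ⟨a, ha⟩ := mem_iUnion.1 (hFc ▸ mem_univ y)
    exact (hfin a).subset fun k hk => ⟨y, hk, ha⟩
  refine ⟨fun k => (s (A k)).1 k, fun k => (s (A k)).2.1 k, ?_, fun k => (s (A k)).2.2.2 k, ?_⟩
  · rw [eq_univ_iff_forall]; intro y
    rw [mem_iUnion]
    obtain ⟨N, hN⟩ := ((hfy y).image A).bddAbove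
    obtain ⟨k, hk⟩ := mem_iUnion.1 ((s N).2.2.1 ▸ mem_univ y)
    refine ⟨k, ?_⟩
    rw [← hconst k N (hN ⟨k, (s N).2.2.2 k hk, rfl⟩)]
    exact hk
  · intro y
    have hf : {k | y ∈ (s (A k)).1 k}.Finite :=
      (hfy y).subset fun k hk => (s (A k)).2.2.2 k hk
    refine ⟨hf, ?_⟩
    obtain ⟨a, ha⟩ := mem_iUnion.1 (hFc ▸ mem_univ y)
    have h1 := n2 a (s a) y ha
    rw [← hs] at h1
    have hss : {k | y ∈ (s (A k)).1 k} ⊆ {k | y ∈ (s (a + 1)).1 k} := fun k hk => hsub k (a+1) hk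
    refine le_trans (Set.ncard_le_ncard hss ?_) h1
    exact (hfy y).subset fun k hk => (s (a+1)).2.2.2 k hk

/-- The main statement about the base: layers. -/
theorem layers {Y κ : Type*} [TopologicalSpace Y] [T2Space Y] [ParacompactSpace Y] {m : ℕ}
    (hdim : CovDimLE Y m) (V : κ → Set Y) (hV : ∀ k, IsOpen (V k)) (hc : ⋃ k, V k = univ) :
    ∃ (G : ℕ → Set Y) (c : ℕ → Y → κ), (∀ i, IsOpen (G i)) ∧ (∀ y, ∃ i ≤ m, y ∈ G i) ∧
      (∀ i, ∀ y ∈ G i, y ∈ V (c i y)) ∧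
      (∀ i, ∀ y ∈ G i, ∀ᶠ y' in 𝓝 y, c i y' = c i y) := by
  classical
  rcases isEmpty_or_nonempty Y with hY | ⟨⟨y00⟩⟩
  · exact ⟨fun _ => ∅, fun i y => (hY.false y).elim, fun _ => isOpen_empty,
      fun y => (hY.false y).elim, fun i y => (hY.false y).elim, fun i y => (hY.false y).elim⟩
  obtain ⟨k00, -⟩ := mem_iUnion.1 (hc ▸ mem_univ y00)
  have : Nonempty κ := ⟨k00⟩
  obtain ⟨G, S, hGo, hGc, hGS, hS⟩ := coloring V hV hc
  -- choose element of S
  let ch : Finset κ → κ := fun T => if h : T.Nonempty then h.choose else k00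
  have hch : ∀ i, ∀ y ∈ G i, y ∈ V (ch (S i y)) := by
    intro i y hy
    have hne : (S i y).Nonempty := by
      rw [← Finset.card_pos, (hGS i y hy).1]; omega
    apply (hGS i y hy).2
    simp only [ch, dif_pos hne]
    exact hne.choose_spec
  -- the exhaustion function
  obtain ⟨ρ, hρ⟩ : ∃ ρ : C(Y, ℝ), ∀ y, ρ y ∈ {r : ℝ | 0 ≤ r ∧ ∃ i : ℕ, (i:ℝ) ≤ r ∧ y ∈ G i} := by
    apply exists_continuous_forall_mem_convex_of_local_const
    · intro y
      apply Set.OrdConnected.convex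
      refine ⟨fun a ha b hb r hr => ⟨ha.1.trans hr.1, ?_⟩⟩
      obtain ⟨i, hi, hy⟩ := ha.2
      exact ⟨i, hi.trans hr.1, hy⟩
    · intro y
      obtain ⟨i, hi⟩ := mem_iUnion.1 (hGc ▸ mem_univ y)
      refine ⟨i, ?_⟩
      filter_upwards [(hGo i).mem_nhds hi] with y' hy'
      exact ⟨Nat.cast_nonneg i, i, le_rfl, hy'⟩
  let W : ℕ × ℕ → Set Y := fun q => {y | y ∈ G q.1 ∧ q.1 ≤ q.2 ∧ (q.2:ℝ) - 1 < ρ y ∧ ρ y < q.2 + 1}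
  let F : ℕ → Set Y := fun a => {y | (a:ℝ) ≤ ρ y ∧ ρ y ≤ a + 1}
  have hWF : ∀ q a, (W q ∩ F a).Nonempty → q.2 ≤ a + 1 ∧ a ≤ q.2 := by
    rintro ⟨i, k⟩ a ⟨y, ⟨h1, h2, h3, h4⟩, h5, h6⟩
    simp only at *
    constructor
    · have : (k:ℝ) < a + 2 := by linarith
      have : k < a + 2 := by exact_mod_cast this
      omega
    · have : (a:ℝ) < k + 1 := by linarith
      have : a < k + 1 := by exact_mod_cast this
      omega
  obtain ⟨H, hHo, hHc, hHW, hHn⟩ := dowker_count hdim W (by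
      rintro ⟨i, k⟩
      by_cases hik : i ≤ k
      · have : W (i, k) = G i ∩ ({y | (k:ℝ) - 1 < ρ y} ∩ {y | ρ y < k + 1}) := by
          ext y; simp only [W, mem_setOf_eq, mem_inter_iff]; tauto
        rw [this]
        exact (hGo i).inter ((isOpen_lt continuous_const ρ.continuous).inter
          (isOpen_lt ρ.continuous continuous_const))
      · have : W (i, k) = ∅ := by ext y; simp [W, hik]
        rw [this]; exact isOpen_empty) (by
      rw [eq_univ_iff_forall]; intro y; rw [mem_iUnion]
      obtain ⟨h0, i, hi, hy⟩ := hρ y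
      refine ⟨(i, ⌊ρ y⌋₊), hy, Nat.le_floor hi, ?_, Nat.lt_floor_add_one _⟩
      have := Nat.floor_le h0
      simp only; linarith) F
    (by
      intro a
      exact (isClosed_le continuous_const ρ.continuous).inter
        (isClosed_le ρ.continuous continuous_const)) (by
      rw [eq_univ_iff_forall]; intro y; rw [mem_iUnion]
      exact ⟨⌊ρ y⌋₊, Nat.floor_le (hρ y).1, (Nat.lt_floor_add_one _).le⟩) (by
      intro a
      apply ((Set.finite_Iic (a+1)).prod (Set.finite_Iic (a+1))).subset
      rintro ⟨i, k⟩ h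
      have h1 := hWF _ _ h
      obtain ⟨y, ⟨_, h2, _, _⟩, _⟩ := h
      simp only at h1 h2
      exact ⟨by simp; omega, by simp; omega⟩) (by
      rintro ⟨i, k⟩
      refine ⟨k+1, fun a ha => ?_⟩
      by_contra hne
      have := (hWF _ _ (nonempty_iff_ne_empty.2 hne)).2
      simp only at this
      omega)
  obtain ⟨G', S', hG'o, hG'c, hG'S, hS'⟩ := coloring H hHo hHc
  let ch' : Finset (ℕ × ℕ) → ℕ × ℕ := fun T => if h : T.Nonempty then h.choose else (0, 0)
  have hch' : ∀ i, ∀ y ∈ G' i, y ∈ H (ch' (S' i y)) := by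
    intro i y hy
    have hne : (S' i y).Nonempty := by
      rw [← Finset.card_pos, (hG'S i y hy).1]; omega
    apply (hG'S i y hy).2
    simp only [ch', dif_pos hne]
    exact hne.choose_spec
  have hG : ∀ i, ∀ y ∈ G' i, y ∈ G (ch' (S' i y)).1 := fun i y hy => (hHW _ (hch' i y hy)).1
  refine ⟨G', fun i y => ch (S (ch' (S' i y)).1 y), hG'o, ?_, ?_, ?_⟩
  · intro y
    obtain ⟨i, hi⟩ := mem_iUnion.1 (hG'c ▸ mem_univ y)
    refine ⟨i, ?_, hi⟩
    have h1 := hG'S i y hi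
    have h2 : ((S' i y : Set (ℕ × ℕ))).ncard ≤ {k | y ∈ H k}.ncard :=
      Set.ncard_le_ncard (fun k hk => h1.2 k hk) (hHn y).1
    rw [Set.ncard_coe_finset, h1.1] at h2
    have := (hHn y).2
    omega
  · intro i y hy
    exact hch _ y (hG i y hy)
  · intro i y hy
    filter_upwards [hS' i y hy, hS _ y (hG i y hy)] with y' h1 h2
    rw [h1, h2]

theorem tube_open {X Y : Type*} [TopologicalSpace X] [TopologicalSpace Y] {f : X → Y}
    (hf : IsClosedMap f) {U : Set X} (hU : IsOpen U) {y : Y} (h : f ⁻¹' {y} ⊆ U) :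
    ∃ V : Set Y, IsOpen V ∧ y ∈ V ∧ f ⁻¹' V ⊆ U := by
  refine ⟨(f '' Uᶜ)ᶜ, (hf _ hU.isClosed_compl).isOpen_compl, ?_, ?_⟩
  · rintro ⟨x, hx, hxy⟩
    exact hx (h hxy)
  · intro x hx
    by_contra hxU
    exact hx ⟨x, hxU, rfl⟩

theorem fiber_lemma {X Y : Type*} [TopologicalSpace X] [TopologicalSpace Y]
    [T2Space X] [T2Space Y] [ParacompactSpace X] {n : ℕ} {f : X → Y} (hperf : IsPerfectMap f)
    (y : Y) (hdim : CovDimLE ↥(f ⁻¹' {y}) n) (N : ℕ) (W : ℕ → Set X) (hW : ∀ l, IsOpen (W l))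
    (hc : ∀ x, f x = y → ∃ l < N, x ∈ W l) :
    ∃ V : Set Y, IsOpen V ∧ y ∈ V ∧ ∃ ψ : ℕ → C(X, ℝ), (∀ l x, 0 ≤ ψ l x) ∧
      (∀ l x, N ≤ l → ψ l x = 0) ∧ ∀ x, f x ∈ V → {l | 0 < ψ l x}.ncard ≤ n + 1 ∧
        (∃ l, 0 < ψ l x) ∧ ∀ l, 0 < ψ l x → x ∈ W l := by
  classical
  obtain ⟨hfc, hfcl, hfcp⟩ := hperf
  let F := f ⁻¹' {y}
  have hFcl : IsClosed F := isClosed_singleton.preimage hfc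
  have : CompactSpace F := isCompact_iff_compactSpace.1 (hfcp y)
  obtain ⟨V, hVo, hVU, hVc, hVn⟩ := hdim (Fin N) (fun i => (↑) ⁻¹' W i) inferInstance
    (fun i => (hW i).preimage continuous_subtype_val) (by
      rw [eq_univ_iff_forall]
      rintro ⟨x, hx⟩
      obtain ⟨l, hl, hxl⟩ := hc x hx
      exact mem_iUnion.2 ⟨⟨l, hl⟩, hxl⟩)
  obtain ⟨φ, hφ⟩ := PartitionOfUnity.exists_isSubordinate isClosed_univ V hVo (by rw [hVc])
  have hext : ∀ i : Fin N, ∃ g : C(X, ℝ), g.restrict F = φ i := fun i =>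
    ContinuousMap.exists_restrict_eq hFcl (φ i)
  choose e he using hext
  have he' : ∀ i (x : F), e i x = φ i x := fun i x => by rw [← he i]; rfl
  let δ : ℝ := 1 / (2 * (N + 1))
  have hδ : 0 < δ := by positivity
  let ψ : ℕ → C(X, ℝ) := fun l => if h : l < N then
    ⟨fun x => max 0 (e ⟨l, h⟩ x - δ), by fun_prop⟩ else 0
  have hψ : ∀ l (h : l < N) x, ψ l x = max 0 (e ⟨l, h⟩ x - δ) := fun l h x => by simp [ψ, h]
  have hψ0 : ∀ l x, N ≤ l → ψ l x = 0 := fun l x h => by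
    simp [ψ, not_lt.2 h]
  have hgood : ∀ x0 ∈ F, ∀ᶠ x in 𝓝 x0, {l | 0 < ψ l x}.ncard ≤ n + 1 ∧
        (∃ l, 0 < ψ l x) ∧ ∀ l, 0 < ψ l x → x ∈ W l := by
    intro x0 hx0
    have e1 : ∀ᶠ x in 𝓝 x0, ∀ i : Fin N, (⟨x0, hx0⟩ : F) ∈ V i → x ∈ W i := by
      rw [Filter.eventually_all]
      intro i
      by_cases hi : (⟨x0, hx0⟩ : F) ∈ V i
      · filter_upwards [(hW i).mem_nhds (hVU i hi)] with x hx _ using hx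
      · exact Filter.Eventually.of_forall fun x hx => absurd hx hi
    have e2 : ∀ᶠ x in 𝓝 x0, ∀ i : Fin N, (⟨x0, hx0⟩ : F) ∉ V i → e i x < δ := by
      rw [Filter.eventually_all]
      intro i
      by_cases hi : (⟨x0, hx0⟩ : F) ∈ V i
      · exact Filter.Eventually.of_forall fun x hx => absurd hi hx
      · have : e i x0 = 0 := by
          rw [he' i ⟨x0, hx0⟩]
          by_contra hne
          exact hi (hφ i (subset_tsupport _ hne))
        have h2 : e i x0 < δ := by rw [this]; exact hδ
        filter_upwards [(e i).continuous.continuousAt.eventually (gt_mem_nhds h2)] with x hx _ using hx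
    obtain ⟨i0, hi0⟩ : ∃ i : Fin N, δ < e i x0 := by
      by_contra hcon
      push Not at hcon
      have h1 : ∑ᶠ i, φ i ⟨x0, hx0⟩ = 1 := φ.sum_eq_one (mem_univ _)
      rw [finsum_eq_sum_of_fintype] at h1
      have h2 : ∑ i, φ i ⟨x0, hx0⟩ ≤ ∑ i : Fin N, δ :=
        Finset.sum_le_sum fun i _ => by rw [← he']; exact hcon i
      rw [h1, Finset.sum_const, Finset.card_univ, Fintype.card_fin, nsmul_eq_mul] at h2
      have : (N:ℝ) * δ < 1 := by
        simp only [δ]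
        rw [mul_one_div, div_lt_one (by positivity)]
        have : (0:ℝ) ≤ N := Nat.cast_nonneg N
        linarith
      linarith
    filter_upwards [e1, e2, (e i0).continuous.continuousAt.eventually (lt_mem_nhds hi0)] with x h1 h2 h3
    have hpos : ∀ l, 0 < ψ l x → ∃ h : l < N, (⟨x0, hx0⟩ : F) ∈ V ⟨l, h⟩ := by
      intro l hl
      by_cases h : l < N
      · refine ⟨h, ?_⟩
        by_contra hV
        have := h2 ⟨l, h⟩ hV
        rw [hψ l h, max_eq_left (by linarith)] at hl
        exact lt_irrefl _ hl
      · rw [hψ0 l x (not_lt.1 h)] at hl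
        exact absurd hl (lt_irrefl _)
    refine ⟨?_, ⟨i0, ?_⟩, ?_⟩
    · have hn := hVn ⟨x0, hx0⟩
      have : {l | 0 < ψ l x}.ncard ≤ {i | (⟨x0, hx0⟩ : F) ∈ V i}.ncard := by
        have hsub : {l | 0 < ψ l x} ⊆ (fun i : Fin N => (i : ℕ)) '' {i | (⟨x0, hx0⟩ : F) ∈ V i} := by
          intro l hl
          obtain ⟨h, hh⟩ := hpos l hl
          exact ⟨⟨l, h⟩, hh, rfl⟩
        exact (Set.ncard_le_ncard hsub (Set.toFinite _)).trans (Set.ncard_image_le (Set.toFinite _))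
      have h4 : (({i | (⟨x0, hx0⟩ : F) ∈ V i}.ncard : ℕ) : ℤ) ≤ n + 1 := hn
      omega
    · rw [hψ i0 i0.2]
      exact lt_max_of_lt_right (by simpa using h3)
    · intro l hl
      obtain ⟨h, hh⟩ := hpos l hl
      exact h1 _ hh
  obtain ⟨U, hU1, hU2, hU3⟩ : ∃ U, IsOpen U ∧ F ⊆ U ∧ ∀ x ∈ U, {l | 0 < ψ l x}.ncard ≤ n + 1 ∧
        (∃ l, 0 < ψ l x) ∧ ∀ l, 0 < ψ l x → x ∈ W l := by
    refine ⟨interior {x | {l | 0 < ψ l x}.ncard ≤ n + 1 ∧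
        (∃ l, 0 < ψ l x) ∧ ∀ l, 0 < ψ l x → x ∈ W l}, isOpen_interior, fun x hx => ?_, ?_⟩
    · exact mem_interior_iff_mem_nhds.2 (hgood x hx)
    · intro x hx
      have := interior_subset hx
      exact this
  obtain ⟨V', hV'o, hyV', hV'⟩ := tube_open hfcl hU1 hU2
  refine ⟨V', hV'o, hyV', ψ, ?_, hψ0, fun x hx => hU3 x (hV' hx)⟩
  intro l x
  by_cases h : l < N
  · rw [hψ l h]; exact le_max_left _ _
  · rw [hψ0 l x (not_lt.1 h)]

/-- open cube -/
def icube (p : ℕ) : Set (EuclideanSpace ℝ (Fin p)) := {x | ∀ i, x i ∈ Set.Ioo (0:ℝ) 1}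

theorem isOpen_icube (p : ℕ) : IsOpen (icube p) := by
  have : icube p = ⋂ i, (fun x : EuclideanSpace ℝ (Fin p) => x i) ⁻¹' Set.Ioo (0:ℝ) 1 := by
    ext x; simp [icube]
  rw [this]
  exact isOpen_iInter_of_finite fun i => isOpen_Ioo.preimage (by fun_prop)

theorem icube_subset (p : ℕ) : icube p ⊆ cube p := fun _ hx i => ⟨(hx i).1.le, (hx i).2.le⟩

theorem icube_dense (p : ℕ) (w : EuclideanSpace ℝ (Fin p)) (hw : w ∈ cube p) {r : ℝ} (hr : 0 < r) :
    ∃ v ∈ icube p, dist v w < r := by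
  let c : EuclideanSpace ℝ (Fin p) := WithLp.toLp 2 fun _ => 1 / 2
  let t : ℝ := min 1 (r / (2 * (‖c - w‖ + 1)))
  have h0 : 0 ≤ ‖c - w‖ := norm_nonneg _
  have ht : 0 < t := lt_min one_pos (by positivity)
  have ht1 : t ≤ 1 := min_le_left _ _
  have ht2 : t ≤ r / (2 * (‖c - w‖ + 1)) := min_le_right _ _
  refine ⟨w + t • (c - w), fun i => ?_, ?_⟩
  · have h1 := hw i
    have : (w + t • (c - w)) i = (1 - t) * w i + t / 2 := by
      simp [c]; ring
    rw [this]
    constructor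
    · have := mul_nonneg (sub_nonneg.2 ht1) h1.1; linarith
    · have := mul_le_mul_of_nonneg_left h1.2 (sub_nonneg.2 ht1); linarith
  · rw [dist_eq_norm, add_sub_cancel_left, norm_smul, Real.norm_of_nonneg ht.le]
    calc t * ‖c - w‖ ≤ r / (2 * (‖c - w‖ + 1)) * ‖c - w‖ := by gcongr
      _ = r * (‖c - w‖ / (2 * (‖c - w‖ + 1))) := by ring
      _ < r * 1 := by
        gcongr
        rw [div_lt_one (by positivity)]; linarith
      _ = r := mul_one r

theorem icube_nonempty (p : ℕ) : (icube p).Nonempty :=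
  ⟨WithLp.toLp 2 fun _ => 1 / 2, fun i => by norm_num⟩

/-- One level of local data. -/
structure Level {X Y H : Type*} [TopologicalSpace X] [TopologicalSpace Y] [PseudoMetricSpace H]
    (f : X → Y) (h : X → H) (p : ℕ) (g : X → EuclideanSpace ℝ (Fin p)) (α : X → ℝ) (ε : ℝ)
    (n : ℕ) where
  V : Y → Set Y
  ψ : Y → ℕ → C(X, ℝ)
  N : Y → ℕ
  Q : Y → ℕ → Set (EuclideanSpace ℝ (Fin p))
  V_open : ∀ k, IsOpen (V k)
  V_cover : ⋃ k, V k = univ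
  V_lf : LocallyFinite V
  nonneg : ∀ k l x, 0 ≤ ψ k l x
  zero : ∀ k l x, N k ≤ l → ψ k l x = 0
  order : ∀ k x, f x ∈ closure (V k) → {l | 0 < ψ k l x}.ncard ≤ n + 1
  pos : ∀ k x, f x ∈ closure (V k) → ∃ l, 0 < ψ k l x
  small : ∀ k l x x', f x ∈ V k → f x' ∈ V k → 0 < ψ k l x → 0 < ψ k l x' → dist (h x) (h x') < ε
  Q_open : ∀ k l, IsOpen (Q k l)
  Q_ne : ∀ k l, (Q k l).Nonempty
  Q_sub : ∀ k l, Q k l ⊆ cube p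
  Q_close : ∀ k l v x, v ∈ Q k l → f x ∈ V k → 0 < ψ k l x → dist v (g x) ≤ α x

/-- refinement of levels -/
def Level.Refines {X Y H : Type*} [TopologicalSpace X] [TopologicalSpace Y] [PseudoMetricSpace H]
    {f : X → Y} {h : X → H} {p : ℕ} {g : X → EuclideanSpace ℝ (Fin p)} {α : X → ℝ} {ε : ℝ}
    {n : ℕ} (L L' : Level f h p g α ε n) : Prop :=
  ∀ k' k l', ∃ l, ∀ x, f x ∈ L'.V k' → f x ∈ L.V k → 0 < L'.ψ k' l' x → 0 < L.ψ k l x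

theorem level_local {X Y H : Type*} [TopologicalSpace X] [TopologicalSpace Y] [PseudoMetricSpace H]
    [T2Space X] [T2Space Y] [ParacompactSpace X]
    {f : X → Y} (hperf : IsPerfectMap f) {h : X → H} (hh : Continuous h)
    {p : ℕ} {g : X → EuclideanSpace ℝ (Fin p)} (hg : Continuous g) (hgc : ∀ x, g x ∈ cube p)
    {α : X → ℝ} (hα : Continuous α) (hα0 : ∀ x, 0 < α x) {ε : ℝ} (hε : 0 < ε)
    {n : ℕ} (y : Y) (hdim : CovDimLE ↥(f ⁻¹' {y}) n) (s : Finset (Level f h p g α ε n)) :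
    ∃ (V : Set Y) (ψ : ℕ → C(X, ℝ)) (N : ℕ), IsOpen V ∧ y ∈ V ∧
      (∀ l x, 0 ≤ ψ l x) ∧ (∀ l x, N ≤ l → ψ l x = 0) ∧
      (∀ x, f x ∈ V → {l | 0 < ψ l x}.ncard ≤ n + 1) ∧ (∀ x, f x ∈ V → ∃ l, 0 < ψ l x) ∧
      (∀ l x x', f x ∈ V → f x' ∈ V → 0 < ψ l x → 0 < ψ l x' → dist (h x) (h x') < ε) ∧
      (∀ l, ∃ Q : Set (EuclideanSpace ℝ (Fin p)), IsOpen Q ∧ Q.Nonempty ∧ Q ⊆ cube p ∧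
        ∀ v x, v ∈ Q → f x ∈ V → 0 < ψ l x → dist v (g x) ≤ α x) ∧
      (∀ L ∈ s, ∀ k l', ∃ l, ∀ x, f x ∈ V → f x ∈ L.V k → 0 < ψ l' x → 0 < L.ψ k l x) := by
  classical
  have hfin : ∀ L : Level f h p g α ε n, {k | y ∈ closure (L.V k)}.Finite :=
    fun L => L.V_lf.closure.point_finite y
  -- local open sets
  have key : ∀ x0, f x0 = y → ∃ W : Set X, IsOpen W ∧ x0 ∈ W ∧
      (∀ x ∈ W, ∀ x' ∈ W, dist (h x) (h x') < ε) ∧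
      (∃ Q : Set (EuclideanSpace ℝ (Fin p)), IsOpen Q ∧ Q.Nonempty ∧ Q ⊆ cube p ∧
        ∀ v x, v ∈ Q → x ∈ W → dist v (g x) ≤ α x) ∧
      (∀ L ∈ s, ∀ k, y ∈ closure (L.V k) → ∃ l, ∀ x ∈ W, 0 < L.ψ k l x) := by
    intro x0 hx0
    have hl : ∀ (L : Level f h p g α ε n) k, y ∈ closure (L.V k) → ∃ l, 0 < L.ψ k l x0 :=
      fun L k hk => L.pos k x0 (by rw [hx0]; exact hk)
    choose! l hl using hl
    refine ⟨(h ⁻¹' Metric.ball (h x0) (ε / 2)) ∩ (g ⁻¹' Metric.ball (g x0) (α x0 / 4)) ∩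
      (α ⁻¹' Ioi (α x0 / 2)) ∩
      ⋂ L ∈ s, ⋂ k ∈ {k | y ∈ closure (L.V k)}, (L.ψ k (l L k)) ⁻¹' Ioi 0, ?_, ?_, ?_, ?_, ?_⟩
    · refine IsOpen.inter (IsOpen.inter (IsOpen.inter ?_ ?_) ?_) ?_
      · exact Metric.isOpen_ball.preimage hh
      · exact Metric.isOpen_ball.preimage hg
      · exact isOpen_Ioi.preimage hα
      · exact isOpen_biInter_finset fun L _ => (hfin L).isOpen_biInter fun k _ =>
          isOpen_Ioi.preimage (L.ψ k _).continuous
    · have := hα0 x0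
      refine ⟨⟨⟨?_, ?_⟩, ?_⟩, ?_⟩
      · simp [hε]
      · simp [this]
      · simp [this]
      · simp only [mem_iInter]
        exact fun L _ k hk => hl L k hk
    · intro x hx x' hx'
      have h1 : dist (h x) (h x0) < ε / 2 := hx.1.1.1
      have h2 : dist (h x') (h x0) < ε / 2 := hx'.1.1.1
      have := dist_triangle_right (h x) (h x') (h x0)
      linarith
    · refine ⟨Metric.ball (g x0) (α x0 / 4) ∩ icube p, Metric.isOpen_ball.inter (isOpen_icube p),
        ?_, fun v hv => icube_subset p hv.2, ?_⟩
      · obtain ⟨v, hv, hd⟩ := icube_dense p (g x0) (hgc x0) (r := α x0 / 4)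
          (by have := hα0 x0; linarith)
        exact ⟨v, hd, hv⟩
      · intro v x hv hx
        have h1 : dist v (g x0) < α x0 / 4 := hv.1
        have h2 : dist (g x) (g x0) < α x0 / 4 := hx.1.1.2
        have h3 : α x0 / 2 < α x := hx.1.2
        have := dist_triangle_right v (g x) (g x0)
        linarith
    · intro L hL k hk
      refine ⟨l L k, fun x hx => ?_⟩
      have := hx.2
      simp only [mem_iInter] at this
      exact this L hL k hk
  choose! W hWo hWm hWs hWQ hWL using key
  obtain ⟨t, ht, htc⟩ := (hperf.2.2 y).elim_nhds_subcover W
    (fun x hx => (hWo x hx).mem_nhds (hWm x hx))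
  let W' : ℕ → Set X := fun l => if hl : l < t.card then W (t.equivFin.symm ⟨l, hl⟩).1 else ∅
  have hW'1 : ∀ l, (∃ x0, f x0 = y ∧ W' l = W x0) ∨ W' l = ∅ := by
    intro l
    by_cases hl : l < t.card
    · left
      exact ⟨_, ht _ (t.equivFin.symm ⟨l, hl⟩).2, by simp [W', hl]⟩
    · right; simp [W', hl]
  have hW'2 : ∀ x, f x = y → ∃ l < t.card, x ∈ W' l := by
    intro x hx
    obtain ⟨x0, hx0, hxx⟩ := mem_iUnion₂.1 (htc hx)
    refine ⟨t.equivFin ⟨x0, hx0⟩, (t.equivFin ⟨x0, hx0⟩).2, ?_⟩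
    simpa [W'] using hxx
  obtain ⟨V, hVo, hyV, ψ, hψ0, hψN, hψ⟩ := fiber_lemma hperf y hdim t.card W' (fun l => by
    rcases hW'1 l with ⟨x0, hx0, h'⟩ | h'
    · rw [h']; exact hWo x0 hx0
    · rw [h']; exact isOpen_empty) hW'2
  let V1 : Set Y := ⋂ L ∈ s, interior (⋂ k, ⋂ (_ : y ∉ closure (L.V k)), (closure (L.V k))ᶜ)
  have hV1o : IsOpen V1 := isOpen_biInter_finset fun L _ => isOpen_interior
  have hyV1 : y ∈ V1 := by
    simp only [V1, mem_iInter]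
    intro L _
    rw [mem_interior_iff_mem_nhds]
    exact L.V_lf.closure.iInter_compl_mem_nhds (fun _ => isClosed_closure) y
  have hV1 : ∀ L ∈ s, ∀ k, y ∉ closure (L.V k) → ∀ y' ∈ V1, y' ∉ L.V k := by
    intro L hL k hk y' hy' hyk
    simp only [V1, mem_iInter] at hy'
    have := interior_subset (hy' L hL)
    simp only [mem_iInter] at this
    exact this k hk (subset_closure hyk)
  refine ⟨V ∩ V1, ψ, t.card, hVo.inter hV1o, ⟨hyV, hyV1⟩, hψ0, hψN, fun x hx => (hψ x hx.1).1,
    fun x hx => (hψ x hx.1).2.1, ?_, ?_, ?_⟩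
  · intro l x x' hx hx' h1 h2
    have h1' := (hψ x hx.1).2.2 l h1
    have h2' := (hψ x' hx'.1).2.2 l h2
    rcases hW'1 l with ⟨x0, hx0, h'⟩ | h'
    · rw [h'] at h1' h2'
      exact hWs x0 hx0 x h1' x' h2'
    · rw [h'] at h1'; exact h1'.elim
  · intro l
    rcases hW'1 l with ⟨x0, hx0, h'⟩ | h'
    · obtain ⟨Q, q1, q2, q3, q4⟩ := hWQ x0 hx0
      refine ⟨Q, q1, q2, q3, fun v x hv hx hp => q4 v x hv ?_⟩
      rw [← h']; exact (hψ x hx.1).2.2 l hp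
    · refine ⟨icube p, isOpen_icube p, icube_nonempty p, icube_subset p, fun v x hv hx hp => ?_⟩
      have := (hψ x hx.1).2.2 l hp
      rw [h'] at this; exact this.elim
  · intro L hL k l'
    by_cases hk : y ∈ closure (L.V k)
    · rcases hW'1 l' with ⟨x0, hx0, h'⟩ | h'
      · obtain ⟨l, hl⟩ := hWL x0 hx0 L hL k hk
        refine ⟨l, fun x hx _ hp => hl x ?_⟩
        rw [← h']; exact (hψ x hx.1).2.2 l' hp
      · refine ⟨0, fun x hx _ hp => ?_⟩
        have := (hψ x hx.1).2.2 l' hp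
        rw [h'] at this; exact this.elim
    · exact ⟨0, fun x hx hxk => absurd hxk (hV1 L hL k hk _ hx.2)⟩

theorem level_step {X Y H : Type*} [TopologicalSpace X] [TopologicalSpace Y] [PseudoMetricSpace H]
    [T2Space X] [T2Space Y] [ParacompactSpace X] [ParacompactSpace Y]
    {f : X → Y} (hperf : IsPerfectMap f) {h : X → H} (hh : Continuous h)
    {p : ℕ} {g : X → EuclideanSpace ℝ (Fin p)} (hg : Continuous g) (hgc : ∀ x, g x ∈ cube p)
    {α : X → ℝ} (hα : Continuous α) (hα0 : ∀ x, 0 < α x) {ε : ℝ} (hε : 0 < ε)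
    {n : ℕ} (hdim : ∀ y, CovDimLE ↥(f ⁻¹' {y}) n) (s : Finset (Level f h p g α ε n)) :
    ∃ L' : Level f h p g α ε n, ∀ L ∈ s, L.Refines L' := by
  classical
  have key := fun y => level_local hperf hh hg hgc hα hα0 hε y (hdim y) s
  choose V ψ N hVo hyV hψ0 hψN hψn hψp hψs hQ hr using key
  choose Q hQo hQn hQc hQd using hQ
  obtain ⟨v, hvo, hvc, hvf, hvV⟩ := precise_refinement V hVo
    (eq_univ_iff_forall.2 fun y => mem_iUnion.2 ⟨y, hyV y⟩)
  obtain ⟨w, hwc, hwo, hwv⟩ := exists_iUnion_eq_closure_subset hvo hvf.point_finite hvc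
  have hwV : ∀ k, w k ⊆ V k := fun k => subset_closure.trans ((hwv k).trans (hvV k))
  have hcwV : ∀ k, closure (w k) ⊆ V k := fun k => (hwv k).trans (hvV k)
  refine ⟨⟨w, ψ, N, Q, hwo, hwc, hvf.subset fun k => subset_closure.trans (hwv k), hψ0, hψN,
    fun k x hx => hψn k x (hcwV k hx), fun k x hx => hψp k x (hcwV k hx),
    fun k l x x' hx hx' => hψs k l x x' (hwV k hx) (hwV k hx'), hQo, hQn, hQc,
    fun k l v x hv hx => hQd k l v x hv (hwV k hx)⟩, fun L hL k' k l' => ?_⟩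
  obtain ⟨l, hl⟩ := hr k' L hL k l'
  exact ⟨l, fun x hx => hl x (hwV k' hx)⟩

theorem levels_exist {X Y H : Type*} [TopologicalSpace X] [TopologicalSpace Y] [PseudoMetricSpace H]
    [T2Space X] [T2Space Y] [ParacompactSpace X] [ParacompactSpace Y]
    {f : X → Y} (hperf : IsPerfectMap f) {h : X → H} (hh : Continuous h)
    {p : ℕ} {g : X → EuclideanSpace ℝ (Fin p)} (hg : Continuous g) (hgc : ∀ x, g x ∈ cube p)
    {α : X → ℝ} (hα : Continuous α) (hα0 : ∀ x, 0 < α x) {ε : ℝ} (hε : 0 < ε)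
    {n : ℕ} (hdim : ∀ y, CovDimLE ↥(f ⁻¹' {y}) n) :
    ∃ L : ℕ → Level f h p g α ε n, ∀ i j, i < j → (L i).Refines (L j) := by
  obtain ⟨L, -, hL⟩ := exists_seq_of_forall_finset_exists (fun _ : Level f h p g α ε n => True)
    (fun L L' => L.Refines L') (fun s _ => by
      obtain ⟨L', hL'⟩ := level_step hperf hh hg hgc hα hα0 hε hdim s
      exact ⟨L', trivial, hL'⟩)
  exact ⟨L, hL⟩

theorem strong_choice {E : Type*} [Inhabited E] (O : ℕ → Set E) (Bad : ℕ → (ℕ → E) → Set E)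
    (hcongr : ∀ q d d', (∀ k < q, d k = d' k) → Bad q d = Bad q d')
    (hex : ∀ q d, ∃ v ∈ O q, v ∉ Bad q d) :
    ∃ d : ℕ → E, ∀ q, d q ∈ O q ∧ d q ∉ Bad q d := by
  choose c hc1 hc2 using hex
  let d : ℕ → E := fun q => Nat.strongRecOn q
    (fun q ih => c q (fun k => if h : k < q then ih k h else default))
  have hd : ∀ q, d q = c q (fun k => if k < q then d k else default) := by
    intro q
    simp only [d]
    rw [Nat.strongRecOn_eq]
    simp
  refine ⟨d, fun q => ⟨by rw [hd]; exact hc1 _ _, ?_⟩⟩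
  rw [hcongr q d (fun k => if k < q then d k else default) (fun k hk => by simp [hk])]
  rw [hd]
  exact hc2 _ _

theorem avoid {p : ℕ} (D : ℕ) (hD : D < p) {ι : Type*} [Countable ι]
    (A : ι → Set (EuclideanSpace ℝ (Fin p))) (hA : ∀ i, dimH (A i) ≤ D)
    (O : Set (EuclideanSpace ℝ (Fin p))) (hO : IsOpen O) (hne : O.Nonempty) :
    ∃ v ∈ O, v ∉ ⋃ i, A i := by
  have h1 : dimH (⋃ i, A i) < Module.finrank ℝ (EuclideanSpace ℝ (Fin p)) := by
    rw [dimH_iUnion]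
    refine lt_of_le_of_lt (iSup_le hA) ?_
    simpa using hD
  obtain ⟨v, hv, hv'⟩ := (dense_compl_of_dimH_lt_finrank h1).inter_open_nonempty O hO hne
  exact ⟨v, hv, hv'⟩

def wv {p m : ℕ} (d : ℕ → EuclideanSpace ℝ (Fin p))
    (Φ : ℕ → (Fin m → ℝ) → EuclideanSpace ℝ (Fin p) × ℝ) (u : Fin m → ℝ) (k : ℕ) :
    EuclideanSpace ℝ (Fin p) × ℝ := (d k, 1) + Φ k u

def GPA {p m : ℕ} (n : ℕ) (F : Set ((Fin m → ℝ) → EuclideanSpace ℝ (Fin p) × ℝ))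
    (d : ℕ → EuclideanSpace ℝ (Fin p)) : Prop :=
  ∀ (S : Finset ℕ) (Φ : ℕ → (Fin m → ℝ) → EuclideanSpace ℝ (Fin p) × ℝ) (u : Fin m → ℝ)
    (b : ℕ → ℝ), S.card ≤ 2 * n + 2 → (∀ k, Φ k ∈ F) → ∑ k ∈ S, b k = 0 →
    ∑ k ∈ S, b k • (wv d Φ u k).1 = 0 → ∀ k ∈ S, b k = 0

def GPR {p m : ℕ} (F : Set ((Fin m → ℝ) → EuclideanSpace ℝ (Fin p) × ℝ))
    (d : ℕ → EuclideanSpace ℝ (Fin p)) : Prop :=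
  ∀ (s : Finset (Fin p)) (r : Fin p → ℚ)
    (S : Finset ℕ) (Φ : ℕ → (Fin m → ℝ) → EuclideanSpace ℝ (Fin p) × ℝ) (u : Fin m → ℝ)
    (b : ℕ → ℝ), S.card + m ≤ s.card → (∀ k, Φ k ∈ F) →
    (∀ i ∈ s, ∑ k ∈ S, b k * ((wv d Φ u k).1 i - (wv d Φ u k).2 * r i) = 0) → ∀ k ∈ S, b k = 0

/-- bad map of type A -/
def badA {p m : ℕ} (φ : ℕ → (Fin m → ℝ) → EuclideanSpace ℝ (Fin p) × ℝ)
    (d : ℕ → EuclideanSpace ℝ (Fin p)) (S : Finset ℕ) (r0 c0 : ℕ) (c : ℕ → ℕ)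
    (z : (Fin m → ℝ) × (S → ℝ)) : EuclideanSpace ℝ (Fin p) :=
  -(φ c0 z.1).1 + (wv d (fun k => φ (c k)) z.1 r0).1
    - ∑ k : S, z.2 k • ((wv d (fun k => φ (c k)) z.1 k).1 - (wv d (fun k => φ (c k)) z.1 r0).1)

/-- bad map of type R -/
def badR {p m : ℕ} (φ : ℕ → (Fin m → ℝ) → EuclideanSpace ℝ (Fin p) × ℝ)
    (d : ℕ → EuclideanSpace ℝ (Fin p)) (s : Finset (Fin p)) (r : Fin p → ℚ)
    (S : Finset ℕ) (c0 : ℕ) (c : ℕ → ℕ)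
    (z : (Fin m → ℝ) × (S → ℝ) × ({i // i ∉ s} → ℝ)) : EuclideanSpace ℝ (Fin p) :=
  WithLp.toLp 2 fun i => if h : i ∈ s then
    (1 + (φ c0 z.1).2) * r i - (φ c0 z.1).1 i
      - ∑ k : S, z.2.1 k * ((wv d (fun k => φ (c k)) z.1 k).1 i -
          (wv d (fun k => φ (c k)) z.1 k).2 * r i)
    else z.2.2 ⟨i, h⟩

theorem wv_contDiff {p m : ℕ} (d : ℕ → EuclideanSpace ℝ (Fin p))
    (Φ : ℕ → (Fin m → ℝ) → EuclideanSpace ℝ (Fin p) × ℝ) (hΦ : ∀ k, ContDiff ℝ 1 (Φ k)) (k : ℕ) :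
    ContDiff ℝ 1 (fun u => wv d Φ u k) := by
  unfold wv
  exact contDiff_const.add (hΦ k)

theorem badA_dim {p m : ℕ} (φ : ℕ → (Fin m → ℝ) → EuclideanSpace ℝ (Fin p) × ℝ)
    (hφ : ∀ k, ContDiff ℝ 1 (φ k))
    (d : ℕ → EuclideanSpace ℝ (Fin p)) (S : Finset ℕ) (r0 c0 : ℕ) (c : ℕ → ℕ) :
    dimH (range (badA φ d S r0 c0 c)) ≤ (m + S.card : ℕ) := by
  have hw : ∀ k, ContDiff ℝ 1
      (fun z : (Fin m → ℝ) × (S → ℝ) => (wv d (fun k => φ (c k)) z.1 k).1) := fun k =>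
    contDiff_fst.comp ((wv_contDiff d (fun k => φ (c k)) (fun k => hφ _) k).comp contDiff_fst)
  have h : ContDiff ℝ 1 (badA φ d S r0 c0 c) := by
    unfold badA
    refine (((contDiff_fst.comp ((hφ c0).comp contDiff_fst)).neg).add (hw r0)).sub
      (ContDiff.sum fun k _ => ?_)
    have hb : ContDiff ℝ 1 (fun z : (Fin m → ℝ) × (S → ℝ) => z.2 k) := by fun_prop
    exact hb.smul ((hw k).sub (hw r0))
  refine h.dimH_range_le.trans ?_
  simp

theorem badR_dim {p m : ℕ} (φ : ℕ → (Fin m → ℝ) → EuclideanSpace ℝ (Fin p) × ℝ)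
    (hφ : ∀ k, ContDiff ℝ 1 (φ k))
    (d : ℕ → EuclideanSpace ℝ (Fin p)) (s : Finset (Fin p)) (r : Fin p → ℚ)
    (S : Finset ℕ) (c0 : ℕ) (c : ℕ → ℕ) :
    dimH (range (badR φ d s r S c0 c)) ≤ (m + S.card + (p - s.card) : ℕ) := by
  have hw : ∀ k, ContDiff ℝ 1
      (fun z : (Fin m → ℝ) × (S → ℝ) × ({i // i ∉ s} → ℝ) => wv d (fun k => φ (c k)) z.1 k) :=
    fun k => (wv_contDiff d (fun k => φ (c k)) (fun k => hφ _) k).comp contDiff_fst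
  have h0 : ContDiff ℝ 1
      (fun z : (Fin m → ℝ) × (S → ℝ) × ({i // i ∉ s} → ℝ) => φ c0 z.1) :=
    (hφ _).comp contDiff_fst
  have hi : ∀ i, ContDiff ℝ 1 (fun x : EuclideanSpace ℝ (Fin p) => x i) := fun i => by fun_prop
  have h : ContDiff ℝ 1 (badR φ d s r S c0 c) := by
    rw [contDiff_euclidean]
    intro i
    by_cases his : i ∈ s
    · simp only [badR, his, dif_pos]
      refine (((contDiff_const.add (contDiff_snd.comp h0)).mul contDiff_const).sub
        ((hi i).comp (contDiff_fst.comp h0))).sub (ContDiff.sum fun k _ => ContDiff.mul ?_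
          (((hi i).comp (contDiff_fst.comp (hw k))).sub ((contDiff_snd.comp (hw k)).mul
            contDiff_const)))
      fun_prop
    · simp only [badR, his, not_false_eq_true, dif_neg]
      fun_prop
  refine h.dimH_range_le.trans ?_
  have : Fintype.card {i // i ∉ s} = p - s.card := by
    rw [Fintype.card_subtype_compl]; simp
  simp [this]
  rw [add_assoc]

theorem palette_layer {p m n : ℕ} (hp : 2 * n + m < p)
    (φ : ℕ → (Fin m → ℝ) → EuclideanSpace ℝ (Fin p) × ℝ) (hφ : ∀ k, ContDiff ℝ 1 (φ k))
    (O : ℕ → Set (EuclideanSpace ℝ (Fin p))) (hO : ∀ q, IsOpen (O q)) (hOn : ∀ q, (O q).Nonempty) :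
    ∃ d : ℕ → EuclideanSpace ℝ (Fin p), (∀ q, d q ∈ O q) ∧ GPA n (range φ) d ∧
      GPR (range φ) d := by
  classical
  let IA := {S : Finset ℕ // S.card ≤ 2 * n} × ℕ × ℕ × (ℕ →₀ ℕ)
  let IR := {sS : Finset (Fin p) × Finset ℕ // sS.2.card + 1 + m ≤ sS.1.card} × (Fin p → ℚ) × ℕ × (ℕ →₀ ℕ)
  let cut : ℕ → (ℕ → EuclideanSpace ℝ (Fin p)) → ℕ → EuclideanSpace ℝ (Fin p) :=
    fun q d k => if k < q then d k else 0
  let A : ℕ → (ℕ → EuclideanSpace ℝ (Fin p)) → (IA ⊕ IR) → Set (EuclideanSpace ℝ (Fin p)) :=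
    fun q d => Sum.elim (fun a => range (badA φ (cut q d) a.1.1 a.2.1 a.2.2.1 a.2.2.2))
      (fun a => range (badR φ (cut q d) a.1.1.1 a.2.1 a.1.1.2 a.2.2.1 a.2.2.2))
  obtain ⟨d, hd⟩ := strong_choice O (fun q d => ⋃ i, A q d i)
    (fun q d d' h => by
      have : cut q d = cut q d' := by
        funext k
        simp only [cut]
        split_ifs with hk
        · exact h k hk
        · rfl
      simp only [A, this])
    (fun q d => by
      refine avoid (p - 1) (by omega) (A q d) ?_ (O q) (hO q) (hOn q)
      rintro (⟨⟨S, hS⟩, r0, c0, c⟩ | ⟨⟨⟨s, S⟩, hS⟩, r, c0, c⟩)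
      · refine (badA_dim φ hφ _ _ _ _ _).trans ?_
        have : m + S.card ≤ p - 1 := by omega
        exact_mod_cast this
      · refine (badR_dim φ hφ _ _ _ _ _ _).trans ?_
        have h1 : s.card ≤ p := by simpa using Finset.card_le_univ s
        simp only at hS
        have : m + S.card + (p - s.card) ≤ p - 1 := by omega
        exact_mod_cast this)
  -- common reduction
  have red : ∀ (S : Finset ℕ) (Φ : ℕ → (Fin m → ℝ) → EuclideanSpace ℝ (Fin p) × ℝ)
      (b : ℕ → ℝ), (∀ k, Φ k ∈ range φ) → (∃ k ∈ S, b k ≠ 0) →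
      ∃ (q : ℕ) (S' : Finset ℕ) (c0 : ℕ) (c : ℕ →₀ ℕ) (β : ℕ → ℝ), S'.card + 1 ≤ S.card ∧
        (∀ k ∈ S', k < q) ∧ φ c0 = Φ q ∧ (∀ k ∈ S', φ (c k) = Φ k) ∧
        (∀ (M : Type) (_ : AddCommGroup M) (_ : Module ℝ M) (w : ℕ → M),
          ∑ k ∈ S, b k • w k = 0 → w q = - ∑ k ∈ S', β k • w k) := by
    intro S Φ b hΦ hne
    let T := S.filter (fun k => b k ≠ 0)
    have hT : T.Nonempty := by
      obtain ⟨k, hk, hb⟩ := hne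
      exact ⟨k, Finset.mem_filter.2 ⟨hk, hb⟩⟩
    choose c0 hc0 using hΦ
    let q := T.max' hT
    have hq : q ∈ T := T.max'_mem hT
    have hbq : b q ≠ 0 := (Finset.mem_filter.1 hq).2
    refine ⟨q, T.erase q, c0 q, Finsupp.onFinset T (fun k => if k ∈ T then c0 k else 0)
      (fun k hk => by by_contra h; simp [h] at hk), fun k => b k / b q, ?_, ?_, hc0 q, ?_, ?_⟩
    · rw [Finset.card_erase_add_one hq]
      exact Finset.card_filter_le _ _
    · intro k hk
      obtain ⟨h1, h2⟩ := Finset.mem_erase.1 hk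
      exact lt_of_le_of_ne (T.le_max' k h2) h1
    · intro k hk
      have h2 := (Finset.mem_erase.1 hk).2
      simp [h2, hc0]
    · intro M _ _ w hw
      have h1 : ∑ k ∈ T, b k • w k = 0 := by
        rw [← hw]
        apply Finset.sum_subset (Finset.filter_subset _ _)
        intro k hk hk'
        have : b k = 0 := by
          by_contra h
          exact hk' (Finset.mem_filter.2 ⟨hk, h⟩)
        rw [this, zero_smul]
      rw [← Finset.add_sum_erase T _ hq] at h1
      have h2 : (b q)⁻¹ • (b q • w q + ∑ k ∈ T.erase q, b k • w k) = 0 := by rw [h1, smul_zero]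
      rw [smul_add, smul_smul, inv_mul_cancel₀ hbq, one_smul, Finset.smul_sum] at h2
      rw [eq_neg_of_add_eq_zero_left h2]
      congr 1
      apply Finset.sum_congr rfl
      intro k _
      show _ = (b k / b q) • w k
      rw [smul_smul, div_eq_inv_mul]
  refine ⟨d, fun q => (hd q).1, ?_, ?_⟩
  · intro S Φ u b hS hΦ hsum hw
    by_contra hcon
    push Not at hcon
    obtain ⟨q, S', c0, c, β, h1, h2, h3, h4, h5⟩ := red S Φ b hΦ hcon
    have e1 := h5 ℝ inferInstance inferInstance (fun _ => 1) (by simpa using hsum)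
    have e2 := h5 (EuclideanSpace ℝ (Fin p)) inferInstance inferInstance
      (fun k => (wv d Φ u k).1) hw
    simp only [smul_eq_mul, mul_one] at e1
    have hne : S'.Nonempty := by
      by_contra h
      rw [Finset.not_nonempty_iff_eq_empty] at h
      simp [h] at e1
    obtain ⟨r0, hr0⟩ := hne
    apply (hd q).2
    rw [mem_iUnion]
    refine ⟨Sum.inl ⟨⟨S'.erase r0, ?_⟩, r0, c0, c⟩, ?_⟩
    · rw [Finset.card_erase_of_mem hr0]; omega
    refine ⟨(u, fun k => β k), ?_⟩
    have hwv : ∀ k ∈ S', wv (cut q d) (fun k => φ (c k)) u k = wv d Φ u k := by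
      intro k hk
      simp [wv, cut, h2 k hk, h4 k hk]
    have hs : ∀ k ∈ S'.erase r0, k ∈ S' := fun k hk => (Finset.mem_erase.1 hk).2
    simp only [badA]
    rw [Finset.sum_coe_sort (S'.erase r0) (fun k => β k • ((wv (cut q d) (fun k => φ (c k)) u k).1 -
      (wv (cut q d) (fun k => φ (c k)) u r0).1)), hwv r0 hr0, h3]
    rw [Finset.sum_congr rfl (fun k hk => by rw [hwv k (hs k hk)])]
    simp only [smul_sub, Finset.sum_sub_distrib, ← Finset.sum_smul]
    rw [← Finset.add_sum_erase S' _ hr0] at e1 e2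
    have e3 : ∑ k ∈ S'.erase r0, β k = -1 - β r0 := by linarith
    rw [e3]
    have e4 : (wv d Φ u q).1 = d q + (Φ q u).1 := rfl
    rw [e4] at e2
    rw [eq_sub_of_add_eq e2]
    module
  · intro s r S Φ u b hS hΦ hw
    by_contra hcon
    push Not at hcon
    obtain ⟨q, S', c0, c, β, h1, h2, h3, h4, h5⟩ := red S Φ b hΦ hcon
    have e2 := fun i hi => h5 ℝ inferInstance inferInstance
      (fun k => (wv d Φ u k).1 i - (wv d Φ u k).2 * r i) (hw i hi)
    apply (hd q).2
    rw [mem_iUnion]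
    refine ⟨Sum.inr ⟨⟨(s, S'), ?_⟩, r, c0, c⟩, ?_⟩
    · simp only; omega
    refine ⟨(u, fun k => β k, fun i => d q i.1), ?_⟩
    have hwv : ∀ k ∈ S', wv (cut q d) (fun k => φ (c k)) u k = wv d Φ u k := by
      intro k hk
      simp [wv, cut, h2 k hk, h4 k hk]
    ext i
    by_cases hi : i ∈ s
    · simp only [badR, hi, dif_pos]
      rw [Finset.sum_coe_sort S' (fun k => β k * ((wv (cut q d) (fun k => φ (c k)) u k).1 i -
        (wv (cut q d) (fun k => φ (c k)) u k).2 * r i)), h3]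
      rw [Finset.sum_congr rfl (fun k hk => by rw [hwv k hk])]
      have e3 := e2 i hi
      simp only [smul_eq_mul] at e3
      have e4 : (wv d Φ u q).1 i = d q i + (Φ q u).1 i := rfl
      have e5 : (wv d Φ u q).2 = 1 + (Φ q u).2 := rfl
      rw [e4, e5] at e3
      linarith
    · simp [badR, hi]

/-- coordinate of the parameter, extended by zero -/
def uext {m : ℕ} (u : Fin m → ℝ) (j : ℕ) : ℝ := if h : j < m then u ⟨j, h⟩ else 0

theorem uext_contDiff {m : ℕ} (j : ℕ) : ContDiff ℝ 1 (fun u : Fin m → ℝ => uext u j) := by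
  unfold uext
  by_cases h : j < m
  · simp only [h, dif_pos]; fun_prop
  · simp only [h, dif_neg, not_false_eq_true]; exact contDiff_const

theorem palettes {p m n : ℕ} (hp : 2 * n + m < p) :
    ∃ (d : ℕ → ℕ → EuclideanSpace ℝ (Fin p))
      (F : ℕ → Set ((Fin m → ℝ) → EuclideanSpace ℝ (Fin p) × ℝ)),
      (fun _ => 0) ∈ F 0 ∧
      (∀ j q, ∀ Φ ∈ F j, (fun u => uext u j • (d j q, (1:ℝ)) + Φ u) ∈ F (j+1)) ∧
      (∀ j, ∀ Φ ∈ F j, ∀ Φ' ∈ F j, (fun u => (1 - uext u j) • Φ u + uext u j • Φ' u) ∈ F (j+1)) ∧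
      (∀ j, GPA n (F j) (d j)) ∧ (∀ j, GPR (F j) (d j)) ∧
      (∀ j l (Q : Set (EuclideanSpace ℝ (Fin p))), IsOpen Q → Q.Nonempty →
        ∃ b, d j (Nat.pair l b) ∈ Q) := by
  classical
  let E := EuclideanSpace ℝ (Fin p)
  obtain ⟨B, hB⟩ : ∃ B : ℕ → Set E, TopologicalSpace.countableBasis E = range B := by
    apply (TopologicalSpace.countable_countableBasis E).exists_eq_range
    obtain ⟨v, hv, -⟩ := (TopologicalSpace.isBasis_countableBasis E).exists_subset_of_mem_open
      (mem_univ (0 : E)) isOpen_univ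
    exact ⟨v, hv⟩
  have hBmem : ∀ b, B b ∈ TopologicalSpace.countableBasis E := fun b => hB ▸ mem_range_self b
  let St := {F : Set ((Fin m → ℝ) → E × ℝ) // F.Countable ∧ F.Nonempty ∧ ∀ Φ ∈ F, ContDiff ℝ 1 Φ}
  have hpal : ∀ F : St, ∃ d : ℕ → E, (∀ q, d q ∈ B (Nat.unpair q).2) ∧ GPA n F.1 d ∧ GPR F.1 d := by
    rintro ⟨F, hF1, hF2, hF3⟩
    obtain ⟨φ, rfl⟩ := hF1.exists_eq_range hF2
    exact palette_layer hp φ (fun k => hF3 _ (mem_range_self k)) (fun q => B (Nat.unpair q).2)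
      (fun q => TopologicalSpace.isOpen_of_mem_countableBasis (hBmem _))
      (fun q => TopologicalSpace.nonempty_of_mem_countableBasis (hBmem _))
  choose pal hpal1 hpal2 hpal3 using hpal
  have hnext : ∀ (j : ℕ) (F : St), ∃ F' : St,
      (∀ q, ∀ Φ ∈ F.1, (fun u => uext u j • (pal F q, (1:ℝ)) + Φ u) ∈ F'.1) ∧
      (∀ Φ ∈ F.1, ∀ Φ' ∈ F.1, (fun u => (1 - uext u j) • Φ u + uext u j • Φ' u) ∈ F'.1) := by
    intro j F
    refine ⟨⟨(⋃ q, (fun (Φ : (Fin m → ℝ) → E × ℝ) u => uext u j • (pal F q, (1:ℝ)) + Φ u) '' F.1) ∪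
      image2 (fun Φ Φ' u => (1 - uext u j) • Φ u + uext u j • Φ' u) F.1 F.1, ?_, ?_, ?_⟩, ?_, ?_⟩
    · exact (countable_iUnion fun q => F.2.1.image _).union (F.2.1.image2 F.2.1 _)
    · exact (F.2.2.1.image2 F.2.2.1).mono subset_union_right
    · rintro Φ (h | ⟨Φ1, h1, Φ2, h2, rfl⟩)
      · obtain ⟨q, Φ', h', rfl⟩ := mem_iUnion.1 h
        exact ((uext_contDiff j).smul contDiff_const).add (F.2.2.2 Φ' h')
      · exact ((contDiff_const.sub (uext_contDiff j)).smul (F.2.2.2 Φ1 h1)).add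
          ((uext_contDiff j).smul (F.2.2.2 Φ2 h2))
    · intro q Φ hΦ
      exact Or.inl (mem_iUnion.2 ⟨q, Φ, hΦ, rfl⟩)
    · intro Φ hΦ Φ' hΦ'
      exact Or.inr ⟨Φ, hΦ, Φ', hΦ', rfl⟩
  choose nxt hn1 hn2 using hnext
  let F : ℕ → St := fun j => Nat.rec ⟨{fun _ => 0}, countable_singleton _, singleton_nonempty _,
    by rintro Φ rfl; exact contDiff_const⟩ (fun j F => nxt j F) j
  have hF : ∀ j, F (j+1) = nxt j (F j) := fun j => rfl
  refine ⟨fun j => pal (F j), fun j => (F j).1, mem_singleton _, fun j => ?_, fun j => ?_,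
    fun j => hpal2 _, fun j => hpal3 _, ?_⟩
  · exact hn1 j (F j)
  · exact hn2 j (F j)
  · rintro j l Q hQ ⟨v, hv⟩
    obtain ⟨w, hw, -, hwQ⟩ := (TopologicalSpace.isBasis_countableBasis E).exists_subset_of_mem_open
      hv hQ
    rw [hB] at hw
    obtain ⟨b, rfl⟩ := hw
    refine ⟨b, hwQ ?_⟩
    have := hpal1 (F j) (Nat.pair l b)
    rwa [Nat.unpair_pair] at this

/-- recursion on vertices -/
def DD {M : Type*} [AddCommGroup M] [Module ℝ M] (s t : ℕ → ℝ) (π : ℕ → ℕ → ℕ → ℕ)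
    (vv : ℕ → ℕ → M) : ℕ → (ℕ → ℕ) → M
  | 0, _ => 0
  | J+1, lam => (1 - s J) • DD s t π vv J lam +
      (t J • vv J (lam J) + s J • DD s t π vv J (π J (lam J)))

/-- recursion on distributions -/
def TT {M : Type*} [AddCommGroup M] [Module ℝ M] (s t : ℕ → ℝ) (π : ℕ → ℕ → ℕ → ℕ) (N : ℕ → ℕ)
    (vv : ℕ → ℕ → M) (P : ℕ → ℕ → ℝ) : ℕ → M
  | 0 => 0
  | J+1 => (1 - s J) • TT s t π N vv P J +
      ∑ l ∈ Finset.range (N J), P J l • (t J • vv J l + s J • DD s t π vv J (π J l))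

section rec
variable {M M' : Type*} [AddCommGroup M] [Module ℝ M] [AddCommGroup M'] [Module ℝ M']
  {s t : ℕ → ℝ} {π : ℕ → ℕ → ℕ → ℕ} {N : ℕ → ℕ} {vv : ℕ → ℕ → M} {P : ℕ → ℕ → ℝ}

theorem DD_map (L : M →ₗ[ℝ] M') (J : ℕ) (lam : ℕ → ℕ) :
    L (DD s t π vv J lam) = DD s t π (fun i l => L (vv i l)) J lam := by
  induction J generalizing lam with
  | zero => simp [DD]
  | succ J ih => simp [DD, ih]

theorem TT_map (L : M →ₗ[ℝ] M') (J : ℕ) :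
    L (TT s t π N vv P J) = TT s t π N (fun i l => L (vv i l)) P J := by
  induction J with
  | zero => simp [TT]
  | succ J ih => simp [TT, ih, DD_map]

theorem DD_cone (C : M → Prop) (h0 : C 0) (hadd : ∀ a b, C a → C b → C (a + b))
    (hsmul : ∀ (c : ℝ) a, 0 ≤ c → C a → C (c • a))
    (hs0 : ∀ i, 0 ≤ s i) (hs1 : ∀ i, s i ≤ 1) (ht : ∀ i, 0 ≤ t i) (rel : ℕ → Prop)
    (hrel : ∀ i, ¬ rel i → s i = 0 ∧ t i = 0) (Pos : ℕ → ℕ → Prop)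
    (hv : ∀ i l, rel i → Pos i l → t i ≠ 0 → C (vv i l))
    (hπ : ∀ J l i, i < J → rel J → rel i → Pos J l → Pos i (π J l i))
    (J : ℕ) (lam : ℕ → ℕ) (hlam : ∀ i < J, rel i → Pos i (lam i)) : C (DD s t π vv J lam) := by
  induction J generalizing lam with
  | zero => exact h0
  | succ J ih =>
    have ih1 := ih lam (fun i hi => hlam i (by omega))
    by_cases hJ : rel J
    · have hp := hlam J (by omega) hJ
      refine hadd _ _ (hsmul _ _ (by linarith [hs1 J]) ih1) (hadd _ _ ?_ (hsmul _ _ (hs0 J)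
        (ih _ fun i hi hri => hπ J _ i hi hJ hri hp)))
      by_cases htJ : t J = 0
      · rw [htJ, zero_smul]; exact h0
      · exact hsmul _ _ (ht J) (hv J _ hJ hp htJ)
    · obtain ⟨h1, h2⟩ := hrel J hJ
      simp only [DD, h1, h2, sub_zero, one_smul, zero_smul, add_zero]
      exact ih1

theorem cone_sum {ι : Type*} (C : M → Prop) (h0 : C 0) (hadd : ∀ a b, C a → C b → C (a + b))
    (S : Finset ι) (g : ι → M) (h : ∀ i ∈ S, C (g i)) : C (∑ i ∈ S, g i) := by
  classical
  induction S using Finset.induction_on with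
  | empty => simpa using h0
  | insert a S ha ih =>
    rw [Finset.sum_insert ha]
    exact hadd _ _ (h a (Finset.mem_insert_self _ _)) (ih fun i hi => h i (Finset.mem_insert_of_mem hi))

theorem TT_cone (C : M → Prop) (h0 : C 0) (hadd : ∀ a b, C a → C b → C (a + b))
    (hsmul : ∀ (c : ℝ) a, 0 ≤ c → C a → C (c • a))
    (hs0 : ∀ i, 0 ≤ s i) (hs1 : ∀ i, s i ≤ 1) (ht : ∀ i, 0 ≤ t i) (rel : ℕ → Prop)
    (hrel : ∀ i, ¬ rel i → s i = 0 ∧ t i = 0) (Pos : ℕ → ℕ → Prop)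
    (hv : ∀ i l, rel i → Pos i l → t i ≠ 0 → C (vv i l))
    (hπ : ∀ J l i, i < J → rel J → rel i → Pos J l → Pos i (π J l i))
    (hP0 : ∀ i l, rel i → 0 ≤ P i l) (hP : ∀ i l, rel i → P i l ≠ 0 → Pos i l)
    (J : ℕ) : C (TT s t π N vv P J) := by
  induction J with
  | zero => exact h0
  | succ J ih =>
    by_cases hJ : rel J
    · refine hadd _ _ (hsmul _ _ (by linarith [hs1 J]) ih) (cone_sum C h0 hadd _ _ fun l _ => ?_)
      by_cases hp : P J l = 0
      · rw [hp, zero_smul]; exact h0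
      have hp' := hP J l hJ hp
      refine hsmul _ _ (hP0 J l hJ) (hadd _ _ ?_ (hsmul _ _ (hs0 J) (DD_cone C h0 hadd hsmul hs0 hs1
        ht rel hrel Pos hv hπ J _ fun i hi hri => hπ J l i hi hJ hri hp')))
      by_cases htJ : t J = 0
      · rw [htJ, zero_smul]; exact h0
      · exact hsmul _ _ (ht J) (hv J _ hJ hp' htJ)
    · obtain ⟨h1, h2⟩ := hrel J hJ
      simp only [TT, h1, h2, sub_zero, one_smul, zero_smul, add_zero, smul_zero,
        Finset.sum_const_zero]
      exact ih

theorem DD_mass (J : ℕ) (lam : ℕ → ℕ) :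
    DD s t π (fun _ _ => (1:ℝ)) J lam = ∑ i ∈ Finset.range J, t i := by
  induction J generalizing lam with
  | zero => simp [DD]
  | succ J ih => simp only [DD, ih, Finset.sum_range_succ, smul_eq_mul]; ring

theorem TT_mass (rel : ℕ → Prop) (hrel : ∀ i, ¬ rel i → s i = 0 ∧ t i = 0)
    (hP : ∀ i, rel i → ∑ l ∈ Finset.range (N i), P i l = 1) (J : ℕ) :
    TT s t π N (fun _ _ => (1:ℝ)) P J = ∑ i ∈ Finset.range J, t i := by
  induction J with
  | zero => simp [TT]
  | succ J ih =>
    simp only [TT, ih, Finset.sum_range_succ, smul_eq_mul, DD_mass, ← Finset.sum_mul]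
    by_cases hJ : rel J
    · rw [hP J hJ]; ring
    · obtain ⟨h1, h2⟩ := hrel J hJ
      rw [h1, h2]; ring

/-- barycentric coordinates over layer `j` -/
def aT (s : ℕ → ℝ) (π : ℕ → ℕ → ℕ → ℕ) (N : ℕ → ℕ) (j : ℕ) (P : ℕ → ℕ → ℝ) (J : ℕ) : ℕ →₀ ℝ :=
  TT s (fun i => if i = j then 1 else 0) π N (fun _ l => Finsupp.single l 1) P J

theorem DD_zero (J : ℕ) (ht : ∀ i < J, t i = 0) (lam : ℕ → ℕ) : DD s t π vv J lam = 0 := by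
  induction J generalizing lam with
  | zero => rfl
  | succ J ih => simp [DD, ih (fun i hi => ht i (by omega)), ht J (by omega)]

theorem TT_zero (J : ℕ) (ht : ∀ i < J, t i = 0) : TT s t π N vv P J = 0 := by
  induction J with
  | zero => rfl
  | succ J ih =>
    simp [TT, ih (fun i hi => ht i (by omega)), ht J (by omega),
      DD_zero J (fun i hi => ht i (by omega))]

theorem DD_lc {j : ℕ} (hsj : s j = 1) (ht : ∀ k, j < k → t k = 0) (J : ℕ) (hJ : j + 1 ≤ J)
    (lam : ℕ → ℕ) :
    DD s t π vv J lam = Finsupp.linearCombination ℝ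
      (fun l => t j • vv j l + DD s t π vv j (π j l))
      (DD s (fun i => if i = j then (1:ℝ) else 0) π (fun _ l => Finsupp.single l (1:ℝ)) J lam) := by
  induction J, hJ using Nat.le_induction generalizing lam with
  | base =>
    have h0 : ∀ lam, DD s (fun i => if i = j then (1:ℝ) else 0) π
        (fun _ l => Finsupp.single l (1:ℝ)) j lam = 0 := fun lam => DD_zero j (fun i hi => by
          simp [hi.ne]) lam
    simp [DD, hsj, h0]
  | succ J hJ ih =>
    have h1 : t J = 0 := ht J (by omega)
    have h2 : (if J = j then (1:ℝ) else 0) = 0 := by simp; omega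
    simp only [DD, h1, h2, zero_smul, zero_add, map_add, map_smul]
    rw [ih, ih]

theorem TT_lc {j : ℕ} (hsj : s j = 1) (ht : ∀ k, j < k → t k = 0) (J : ℕ) (hJ : j + 1 ≤ J) :
    TT s t π N vv P J = Finsupp.linearCombination ℝ
      (fun l => t j • vv j l + DD s t π vv j (π j l)) (aT s π N j P J) := by
  unfold aT
  induction J, hJ using Nat.le_induction with
  | base =>
    have h0 : ∀ lam, DD s (fun i => if i = j then (1:ℝ) else 0) π
        (fun _ l => Finsupp.single l (1:ℝ)) j lam = 0 := fun lam => DD_zero j (fun i hi => by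
          simp [hi.ne]) lam
    simp [TT, hsj, h0]
  | succ J hJ ih =>
    have h1 : t J = 0 := ht J (by omega)
    have h2 : (if J = j then (1:ℝ) else 0) = 0 := by simp; omega
    simp only [TT, h1, h2, zero_smul, zero_add, map_add, map_smul, map_sum]
    rw [ih]
    congr 1
    refine Finset.sum_congr rfl fun l _ => ?_
    rw [DD_lc hsj ht J hJ]

end rec

theorem DD_fam {p m : ℕ} {d : ℕ → ℕ → EuclideanSpace ℝ (Fin p)}
    {F : ℕ → Set ((Fin m → ℝ) → EuclideanSpace ℝ (Fin p) × ℝ)}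
    (hF0 : (fun _ => 0) ∈ F 0)
    (hF1 : ∀ j q, ∀ Φ ∈ F j, (fun u => uext u j • (d j q, (1:ℝ)) + Φ u) ∈ F (j+1))
    (hF2 : ∀ j, ∀ Φ ∈ F j, ∀ Φ' ∈ F j, (fun u => (1 - uext u j) • Φ u + uext u j • Φ' u) ∈ F (j+1))
    {s t : ℕ → ℝ} {π : ℕ → ℕ → ℕ → ℕ} (q : ℕ → ℕ → ℕ) {tj : ℝ} (htj : tj ≠ 0)
    (hst : ∀ i, t i ≠ 0 → s i = 1) (J : ℕ) (hJ : J ≤ m) (lam : ℕ → ℕ) :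
    ∃ Φ ∈ F J, DD s t π (fun i l => (d i (q i l), (1:ℝ))) J lam =
      tj • Φ (fun i : Fin m => if t i = 0 then s i else t i / tj) := by
  induction J generalizing lam with
  | zero => exact ⟨_, hF0, by simp [DD]⟩
  | succ J ih =>
    obtain ⟨Φ, hΦ, h1⟩ := ih (by omega) lam
    obtain ⟨Φ', hΦ', h2⟩ := ih (by omega) (π J (lam J))
    have hu : uext (fun i : Fin m => if t i = 0 then s i else t i / tj) J =
        if t J = 0 then s J else t J / tj := by
      simp [uext, show J < m by omega]
    by_cases ht : t J = 0
    · refine ⟨_, hF2 J Φ hΦ Φ' hΦ', ?_⟩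
      simp only [DD, hu, ht, if_true, h1, h2]
      module
    · refine ⟨_, hF1 J (q J (lam J)) Φ' hΦ', ?_⟩
      simp only [DD, hu, ht, if_false, h1, h2, hst J ht]
      have hm : tj * (t J / tj) = t J := by field_simp
      rw [smul_add, smul_smul tj (t J / tj), hm]
      module

theorem gp_A {p m n : ℕ} {F : Set ((Fin m → ℝ) → EuclideanSpace ℝ (Fin p) × ℝ)}
    {d : ℕ → EuclideanSpace ℝ (Fin p)} (h : GPA n F d) {Φ : ℕ → (Fin m → ℝ) → _}
    (hΦ : ∀ k, Φ k ∈ F) {tj : ℝ} (htj : tj ≠ 0) (u : Fin m → ℝ) (β : ℕ → ℕ)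
    {e : ℕ → EuclideanSpace ℝ (Fin p) × ℝ}
    (he : ∀ l, e l = tj • ((d (Nat.pair l (β l)), (1:ℝ)) + Φ l u))
    (c : ℕ →₀ ℝ) (hc : c.support.card ≤ 2 * n + 2) (hsum : ∑ l ∈ c.support, c l = 0)
    (hlc : (Finsupp.linearCombination ℝ e c).1 = 0) : c = 0 := by
  classical
  have hinj : Function.Injective (fun l => Nat.pair l (β l)) := fun l l' hl => by
    have := congrArg (fun k => (Nat.unpair k).1) hl
    simpa using this
  have key := h (c.support.image (fun l => Nat.pair l (β l))) (fun k => Φ (Nat.unpair k).1) u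
    (fun k => c (Nat.unpair k).1) (Finset.card_image_le.trans hc) (fun k => hΦ _)
    (by rw [Finset.sum_image hinj.injOn]; simpa using hsum)
    (by
      rw [Finset.sum_image hinj.injOn]
      rw [Finsupp.linearCombination_apply, Finsupp.sum, Prod.fst_sum] at hlc
      have h2 : tj • ∑ l ∈ c.support, c l • (d (Nat.pair l (β l)) + (Φ l u).1) = 0 := by
        rw [Finset.smul_sum, ← hlc]
        refine Finset.sum_congr rfl fun l _ => ?_
        rw [he, smul_comm]; rfl
      simpa [wv] using (smul_eq_zero.1 h2).resolve_left htj)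
  ext l
  by_contra hl
  have hl' : l ∈ c.support := by simpa using hl
  have := key _ (Finset.mem_image_of_mem _ hl')
  simp at this
  exact hl this

theorem gp_R {p m : ℕ} {F : Set ((Fin m → ℝ) → EuclideanSpace ℝ (Fin p) × ℝ)}
    {d : ℕ → EuclideanSpace ℝ (Fin p)} (h : GPR F d) {Φ : ℕ → (Fin m → ℝ) → _}
    (hΦ : ∀ k, Φ k ∈ F) {tj : ℝ} (htj : tj ≠ 0) (u : Fin m → ℝ) (β : ℕ → ℕ)
    {e : ℕ → EuclideanSpace ℝ (Fin p) × ℝ}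
    (he : ∀ l, e l = tj • ((d (Nat.pair l (β l)), (1:ℝ)) + Φ l u))
    (c : ℕ →₀ ℝ) (s : Finset (Fin p)) (r : Fin p → ℚ) (hc : c.support.card + m ≤ s.card)
    (hlc : ∀ i ∈ s, (Finsupp.linearCombination ℝ e c).1 i =
      (Finsupp.linearCombination ℝ e c).2 * r i) : c = 0 := by
  classical
  have hinj : Function.Injective (fun l => Nat.pair l (β l)) := fun l l' hl => by
    have := congrArg (fun k => (Nat.unpair k).1) hl
    simpa using this
  have key := h s r (c.support.image (fun l => Nat.pair l (β l))) (fun k => Φ (Nat.unpair k).1) u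
    (fun k => c (Nat.unpair k).1) ((Nat.add_le_add_right Finset.card_image_le m).trans hc) (fun k => hΦ _)
    (by
      intro i hi
      rw [Finset.sum_image hinj.injOn]
      have h1 := hlc i hi
      rw [Finsupp.linearCombination_apply, Finsupp.sum, Prod.fst_sum, Prod.snd_sum,
        Finset.sum_mul] at h1
      have h0 : (∑ l ∈ c.support, (c l • e l).1) i = ∑ l ∈ c.support, (c l • e l).1 i := by
        simp
      rw [h0, ← sub_eq_zero, ← Finset.sum_sub_distrib] at h1
      have h2 : tj * ∑ l ∈ c.support, c l * ((d (Nat.pair l (β l)) + (Φ l u).1) i -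
          (1 + (Φ l u).2) * r i) = 0 := by
        rw [Finset.mul_sum, ← h1]
        refine Finset.sum_congr rfl fun l _ => ?_
        rw [he]
        simp
        ring
      simpa [wv] using (mul_eq_zero.1 h2).resolve_left htj)
  ext l
  by_contra hl
  have hl' : l ∈ c.support := by simpa using hl
  have := key _ (Finset.mem_image_of_mem _ hl')
  simp at this
  exact hl this

theorem DD_contAt {Y M : Type*} [TopologicalSpace Y] [TopologicalSpace M] [AddCommGroup M]
    [Module ℝ M] [ContinuousAdd M] [ContinuousSMul ℝ M]
    {s t : ℕ → Y → ℝ} (hs : ∀ i, Continuous (s i)) (ht : ∀ i, Continuous (t i))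
    {G : ℕ → Set Y} {π : ℕ → Y → ℕ → ℕ → ℕ} {vv : ℕ → Y → ℕ → M}
    (hz : ∀ i, ∀ y0, y0 ∉ G i → ∀ᶠ y in 𝓝 y0, s i y = 0 ∧ t i y = 0)
    (hv : ∀ i, ∀ y0 ∈ G i, ∀ᶠ y in 𝓝 y0, vv i y = vv i y0)
    (hπ : ∀ J i y0, i < J → y0 ∈ G J → y0 ∈ G i → ∀ l, ∀ᶠ y in 𝓝 y0, π J y l i = π J y0 l i)
    (J : ℕ) (lam : Y → ℕ → ℕ) (y0 : Y)
    (hlam : ∀ i < J, y0 ∈ G i → ∀ᶠ y in 𝓝 y0, lam y i = lam y0 i) :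
    ContinuousAt (fun y => DD (fun i => s i y) (fun i => t i y) (fun J => π J y) (fun i => vv i y)
      J (lam y)) y0 := by
  induction J generalizing lam with
  | zero => exact continuousAt_const
  | succ J ih =>
    have ih1 := ih lam (fun i hi => hlam i (by omega))
    by_cases hJ : y0 ∈ G J
    · have ih2 := ih (fun y => π J y (lam y0 J)) (fun i hi hy => hπ J i y0 hi hJ hy _)
      have hc : ContinuousAt (fun y => (1 - s J y) • DD (fun i => s i y) (fun i => t i y)
          (fun J => π J y) (fun i => vv i y) J (lam y) + (t J y • vv J y0 (lam y0 J) +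
          s J y • DD (fun i => s i y) (fun i => t i y)
          (fun J => π J y) (fun i => vv i y) J (π J y (lam y0 J)))) y0 :=
        ((continuousAt_const.sub (hs J).continuousAt).smul ih1).add
          (((ht J).continuousAt.smul continuousAt_const).add ((hs J).continuousAt.smul ih2))
      refine hc.congr ?_
      filter_upwards [hv J y0 hJ, hlam J (by omega) hJ] with y h1 h2
      simp only [DD, h1, h2]
    · refine ih1.congr ?_
      filter_upwards [hz J y0 hJ] with y h
      simp [DD, h.1, h.2]

theorem TT_contAt {X Y M : Type*} [TopologicalSpace X] [TopologicalSpace Y] [TopologicalSpace M]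
    [AddCommGroup M] [Module ℝ M] [ContinuousAdd M] [ContinuousSMul ℝ M]
    {f : X → Y} (hf : Continuous f)
    {s t : ℕ → Y → ℝ} (hs : ∀ i, Continuous (s i)) (ht : ∀ i, Continuous (t i))
    {G : ℕ → Set Y} {π : ℕ → Y → ℕ → ℕ → ℕ} {vv : ℕ → Y → ℕ → M} {N : ℕ → Y → ℕ}
    {P : ℕ → X → ℕ → ℝ}
    (hz : ∀ i, ∀ y0, y0 ∉ G i → ∀ᶠ y in 𝓝 y0, s i y = 0 ∧ t i y = 0)
    (hv : ∀ i, ∀ y0 ∈ G i, ∀ᶠ y in 𝓝 y0, vv i y = vv i y0)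
    (hN : ∀ i, ∀ y0 ∈ G i, ∀ᶠ y in 𝓝 y0, N i y = N i y0)
    (hπ : ∀ J i y0, i < J → y0 ∈ G J → y0 ∈ G i → ∀ l, ∀ᶠ y in 𝓝 y0, π J y l i = π J y0 l i)
    (hP : ∀ i x0 l, f x0 ∈ G i → ContinuousAt (fun x => P i x l) x0)
    (J : ℕ) (x0 : X) :
    ContinuousAt (fun x => TT (fun i => s i (f x)) (fun i => t i (f x)) (fun J => π J (f x))
      (fun i => N i (f x)) (fun i => vv i (f x)) (fun i => P i x) J) x0 := by
  induction J with
  | zero => exact continuousAt_const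
  | succ J ih =>
    have hsJ : ContinuousAt (fun x => s J (f x)) x0 := ((hs J).comp hf).continuousAt
    have htJ : ContinuousAt (fun x => t J (f x)) x0 := ((ht J).comp hf).continuousAt
    by_cases hJ : f x0 ∈ G J
    · have ih2 : ∀ l, ContinuousAt (fun x => DD (fun i => s i (f x)) (fun i => t i (f x))
          (fun J => π J (f x)) (fun i => vv i (f x)) J (π J (f x) l)) x0 := fun l =>
        ContinuousAt.comp' (DD_contAt hs ht hz hv hπ J (fun y => π J y l) (f x0)
          (fun i hi hy => hπ J i (f x0) hi hJ hy l)) hf.continuousAt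
      have hc : ContinuousAt (fun x => (1 - s J (f x)) • TT (fun i => s i (f x))
          (fun i => t i (f x)) (fun J => π J (f x))
          (fun i => N i (f x)) (fun i => vv i (f x)) (fun i => P i x) J +
          ∑ l ∈ Finset.range (N J (f x0)), P J x l • (t J (f x) • vv J (f x0) l +
          s J (f x) • DD (fun i => s i (f x)) (fun i => t i (f x))
          (fun J => π J (f x)) (fun i => vv i (f x)) J (π J (f x) l))) x0 := by
        refine ((continuousAt_const.sub hsJ).smul ih).add ?_
        refine tendsto_finsetSum _ fun l _ => ?_
        exact (hP J x0 l hJ).smul ((htJ.smul continuousAt_const).add (hsJ.smul (ih2 l)))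
      refine hc.congr ?_
      filter_upwards [hf.continuousAt.eventually (hv J _ hJ),
        hf.continuousAt.eventually (hN J _ hJ)] with x h1 h2
      simp only [TT, h1, h2]
    · refine ih.congr ?_
      filter_upwards [hf.continuousAt.eventually (hz J _ hJ)] with x h
      simp [TT, h.1, h.2]

/-- fiberwise separation at scale `ε` -/
def GoodA {X Y H E : Type*} [PseudoMetricSpace H] (f : X → Y) (h : X → H) (ε : ℝ) (g : X → E) :
    Prop := ∀ x x', f x = f x' → ε ≤ dist (h x) (h x') → g x ≠ g x'

def GoodR {X Y H : Type*} [TopologicalSpace X] [PseudoMetricSpace H] {p : ℕ} (f : X → Y) (h : X → H)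
    (ε : ℝ) (s : Finset (Fin p)) (r : Fin p → ℚ) (d : ℕ) (g : X → EuclideanSpace ℝ (Fin p)) :
    Prop := ∀ y, ∃ (ι : Type) (_ : Finite ι) (O : ι → Set X), (∀ i, IsOpen (O i)) ∧
      (∀ i, ∀ x ∈ O i, ∀ x' ∈ O i, dist (h x) (h x') < ε) ∧ (∀ x, {i | x ∈ O i}.ncard ≤ d) ∧
      ∀ x, f x = y → (∀ i ∈ s, g x i = (r i : ℝ)) → ∃ i, x ∈ O i

/-- local representation in general position -/
def LocRep {X Y H : Type*} [TopologicalSpace X] [PseudoMetricSpace H] {p : ℕ} (f : X → Y) (h : X → H)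
    (ε : ℝ) (n m : ℕ) (g : X → EuclideanSpace ℝ (Fin p)) (y : Y) : Prop :=
  ∃ (W : ℕ → Set X) (N : ℕ) (a : X → ℕ →₀ ℝ), (∀ l, IsOpen (W l)) ∧
    (∀ l, ∀ x ∈ W l, ∀ x' ∈ W l, dist (h x) (h x') < ε) ∧
    (∀ x, f x = y → (∀ l, 0 ≤ a x l) ∧ (∀ l, a x l ≠ 0 → x ∈ W l ∧ l < N) ∧ a x ≠ 0 ∧
      (a x).support.card ≤ n + 1 ∧ ∀ (s : Finset (Fin p)) (r : Fin p → ℚ),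
        (∀ i ∈ s, g x i = (r i : ℝ)) → s.card < (a x).support.card + m) ∧
    (∀ l, ContinuousOn (fun x => a x l) (f ⁻¹' {y})) ∧
    (∀ x x', f x = y → f x' = y → g x = g x' → a x = a x')

theorem goodA_of {X Y H : Type*} [TopologicalSpace X] [PseudoMetricSpace H] {p : ℕ} {f : X → Y}
    {h : X → H} {ε : ℝ} {n m : ℕ} {g : X → EuclideanSpace ℝ (Fin p)}
    (hl : ∀ y, LocRep f h ε n m g y) : GoodA f h ε g := by
  intro x x' hf hd he
  obtain ⟨W, N, a, hW, hs, hx, hc, hA⟩ := hl (f x)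
  have h1 := hA x x' rfl hf.symm he
  obtain ⟨-, h2, h3, -⟩ := hx x rfl
  obtain ⟨-, h2', -, -⟩ := hx x' hf.symm
  obtain ⟨l, hl⟩ := Finsupp.ne_iff.1 h3
  have := hs l x (h2 l hl).1 x' (h2' l (h1 ▸ hl)).1
  linarith

theorem goodR_of {X Y H : Type*} [TopologicalSpace X] [TopologicalSpace Y] [T1Space Y]
    [NormalSpace X] [PseudoMetricSpace H] {p : ℕ} {f : X → Y} (hf : Continuous f)
    {h : X → H} {ε : ℝ} {n m : ℕ} {g : X → EuclideanSpace ℝ (Fin p)}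
    (hl : ∀ y, LocRep f h ε n m g y) (s : Finset (Fin p)) (r : Fin p → ℚ) (hsm : m + 1 ≤ s.card) :
    GoodR f h ε s r (n + m + 1 - s.card) g := by
  classical
  intro y
  obtain ⟨W, N, a, hW, hs, hx, hc, hA⟩ := hl y
  have hcl : IsClosed (f ⁻¹' {y}) := isClosed_singleton.preimage hf
  have hext : ∀ l, ∃ b : C(X, ℝ), ∀ x, f x = y → b x = a x l := fun l => by
    obtain ⟨b, hb⟩ := ContinuousMap.exists_restrict_eq hcl
      (⟨fun x => a x l, continuousOn_iff_continuous_domRestrict.1 (hc l)⟩ : C(f ⁻¹' {y}, ℝ))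
    exact ⟨b, fun x hx => congrArg (fun φ : C(f ⁻¹' {y}, ℝ) => φ ⟨x, hx⟩) hb⟩
  choose b hb using hext
  let I : Finset (Finset ℕ) := (Finset.range N).powerset.filter
    fun S => s.card < S.card + m ∧ S.card ≤ n + 1
  let O : I → Set X := fun S => ⋂ l ∈ S.1, (W l ∩ ⋂ l' ∈ Finset.range N \ S.1, {x | b l' x < b l x})
  refine ⟨I, inferInstance, O, fun S => ?_, ?_, ?_, ?_⟩
  · refine isOpen_biInter_finset fun l _ => (hW l).inter (isOpen_biInter_finset fun l' _ => ?_)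
    exact isOpen_lt (b l').continuous (b l).continuous
  · rintro ⟨S, hS⟩ x hx x' hx'
    have hS' := (Finset.mem_filter.1 hS).2
    obtain ⟨l, hl⟩ : S.Nonempty := Finset.card_pos.1 (by omega)
    exact hs l x (mem_iInter₂.1 hx l hl).1 x' (mem_iInter₂.1 hx' l hl).1
  · intro x
    have hinj : InjOn (fun S : I => S.1.card) {S | x ∈ O S} := by
      rintro ⟨S, hS⟩ hxS ⟨S', hS'⟩ hxS' hcard
      simp only at hcard
      have e1 := Finset.mem_powerset.1 (Finset.mem_filter.1 hS).1
      have e2 := Finset.mem_powerset.1 (Finset.mem_filter.1 hS').1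
      by_contra hne
      have hne' : S ≠ S' := fun h => hne (Subtype.ext h)
      have h1 : ¬ S ⊆ S' := fun h => hne' (Finset.eq_of_subset_of_card_le h hcard.ge)
      have h2 : ¬ S' ⊆ S := fun h => hne' (Finset.eq_of_subset_of_card_le h hcard.le).symm
      obtain ⟨l, hl, hl'⟩ := Finset.not_subset.1 h1
      obtain ⟨k, hk, hk'⟩ := Finset.not_subset.1 h2
      have i1 := mem_iInter₂.1 (mem_iInter₂.1 hxS l hl).2 k (Finset.mem_sdiff.2 ⟨e2 hk, hk'⟩)
      have i2 := mem_iInter₂.1 (mem_iInter₂.1 hxS' k hk).2 l (Finset.mem_sdiff.2 ⟨e1 hl, hl'⟩)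
      exact lt_asymm (show b k x < b l x from i1) i2
    have hsub : (fun S : I => S.1.card) '' {S | x ∈ O S} ⊆
        (Finset.Icc (s.card - m + 1) (n + 1) : Finset ℕ) := by
      rintro _ ⟨⟨S, hS⟩, -, rfl⟩
      have := (Finset.mem_filter.1 hS).2
      simp only [Finset.coe_Icc, mem_Icc]
      omega
    calc _ = ((fun S : I => S.1.card) '' {S | x ∈ O S}).ncard := (InjOn.ncard_image hinj).symm
      _ ≤ (↑(Finset.Icc (s.card - m + 1) (n + 1)) : Set ℕ).ncard :=
        ncard_le_ncard hsub (Finset.finite_toSet _)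
      _ = _ := by rw [ncard_coe_finset, Nat.card_Icc]; omega
  · intro x hfx hg
    obtain ⟨h0, h1, h2, h3, h4⟩ := hx x hfx
    refine ⟨⟨(a x).support, Finset.mem_filter.2 ⟨Finset.mem_powerset.2 fun l hl => ?_, h4 s r hg, h3⟩⟩,
      ?_⟩
    · exact Finset.mem_range.2 (h1 l (Finsupp.mem_support_iff.1 hl)).2
    · refine mem_iInter₂.2 fun l hl => ⟨(h1 l (Finsupp.mem_support_iff.1 hl)).1,
        mem_iInter₂.2 fun l' hl' => ?_⟩
      have hz : a x l' = 0 := by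
        simpa using (Finset.mem_sdiff.1 hl').2
      show b l' x < b l x
      rw [hb _ _ hfx, hb _ _ hfx, hz]
      exact lt_of_le_of_ne (h0 l) (Ne.symm (Finsupp.mem_support_iff.1 hl))

theorem layer_data {Y : Type*} [TopologicalSpace Y] [T2Space Y] [ParacompactSpace Y] {m : ℕ}
    (hdim : CovDimLE Y m) (V : ℕ → Y → Set Y) (hV : ∀ i k, IsOpen (V i k))
    (hc : ∀ i, ⋃ k, V i k = univ) :
    ∃ (G : ℕ → Set Y) (k : ℕ → Y → Y) (s t : ℕ → Y → ℝ),
      (∀ i, ∀ y ∈ G i, y ∈ V i (k i y)) ∧ (∀ i, ∀ y ∈ G i, ∀ᶠ y' in 𝓝 y, k i y' = k i y) ∧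
      (∀ i, Continuous (s i)) ∧ (∀ i, Continuous (t i)) ∧ (∀ i y, 0 ≤ s i y) ∧
      (∀ i y, s i y ≤ 1) ∧ (∀ i y, 0 ≤ t i y) ∧ (∀ y, ∑ i ∈ Finset.range (m+1), t i y = 1) ∧
      (∀ i y, t i y ≠ 0 → s i y = 1) ∧ (∀ i y, m < i → t i y = 0) ∧
      (∀ i, ∀ y0, y0 ∉ G i → ∀ᶠ y in 𝓝 y0, s i y = 0 ∧ t i y = 0) := by
  classical
  have hc' : ⋃ κ : Fin (m+1) → Y, ⋂ i : Fin (m+1), V i (κ i) = univ := by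
    refine eq_univ_of_forall fun y => ?_
    have : ∀ i : Fin (m+1), ∃ k, y ∈ V i k := fun i => mem_iUnion.1 (hc i ▸ mem_univ y)
    choose κ hκ using this
    exact mem_iUnion.2 ⟨κ, mem_iInter.2 hκ⟩
  obtain ⟨G, c, hG, hGc, hGV, hcl⟩ := layers hdim (fun κ : Fin (m+1) → Y => ⋂ i : Fin (m+1), V i (κ i))
    (fun κ => isOpen_iInter_of_finite fun i => hV _ _) hc'
  obtain ⟨t, ht⟩ := PartitionOfUnity.exists_isSubordinate (s := univ) isClosed_univ
    (fun i : Fin (m+1) => G i) (fun i => hG _) (fun y _ => by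
      obtain ⟨i, hi, hy⟩ := hGc y
      exact mem_iUnion.2 ⟨⟨i, by omega⟩, hy⟩)
  have hs : ∀ i : Fin (m+1), ∃ (s : C(Y, ℝ)), (∀ y, 0 ≤ s y ∧ s y ≤ 1) ∧ (∀ y, t i y ≠ 0 → s y = 1) ∧
      ∀ y0, y0 ∉ G i → ∀ᶠ y in 𝓝 y0, s y = 0 ∧ t i y = 0 := by
    intro i
    obtain ⟨W, hW, h1, h2⟩ := normal_exists_closure_subset (isClosed_tsupport (t i)) (hG i) (ht i)
    obtain ⟨s, hs0, hs1, hs⟩ := exists_continuous_zero_one_of_isClosed hW.isClosed_compl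
      (isClosed_tsupport (t i)) (disjoint_compl_left_iff_subset.2 h1)
    refine ⟨s, fun y => hs y, fun y hy => hs1 (subset_tsupport _ hy), fun y0 hy0 => ?_⟩
    have : (closure W)ᶜ ∈ 𝓝 y0 := isClosed_closure.isOpen_compl.mem_nhds fun h => hy0 (h2 h)
    filter_upwards [this] with y hy
    refine ⟨hs0 fun h => hy (subset_closure h), ?_⟩
    by_contra hne
    exact hy (subset_closure (h1 (subset_tsupport _ hne)))
  choose s hs01 hs1 hs0 using hs
  refine ⟨fun i => if i < m + 1 then G i else ∅, fun i y => if h : i < m + 1 then c i y ⟨i, h⟩ else y,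
    fun i y => if h : i < m + 1 then s ⟨i, h⟩ y else 0,
    fun i y => if h : i < m + 1 then t ⟨i, h⟩ y else 0, ?_, ?_, ?_, ?_, ?_, ?_, ?_, ?_, ?_, ?_, ?_⟩
  · intro i y hy
    by_cases h : i < m + 1
    · simp only [h, if_true, dif_pos] at hy ⊢
      exact mem_iInter.1 (hGV i y hy) ⟨i, h⟩
    · simp [h] at hy
  · intro i y hy
    by_cases h : i < m + 1
    · simp only [h, if_true, dif_pos] at hy ⊢
      filter_upwards [hcl i y hy] with y' hy'
      rw [hy']
    · simp [h] at hy
  · intro i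
    by_cases h : i < m + 1
    · simp only [h, dif_pos]; exact (s _).continuous
    · simp only [h, dif_neg, not_false_eq_true]; exact continuous_const
  · intro i
    by_cases h : i < m + 1
    · simp only [h, dif_pos]; exact (t _).continuous
    · simp only [h, dif_neg, not_false_eq_true]; exact continuous_const
  · intro i y
    by_cases h : i < m + 1
    · simp only [h, dif_pos]; exact (hs01 _ _).1
    · simp [h]
  · intro i y
    by_cases h : i < m + 1
    · simp only [h, dif_pos]; exact (hs01 _ _).2
    · simp [h]
  · intro i y
    by_cases h : i < m + 1
    · simp only [h, dif_pos]; exact t.nonneg _ _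
    · simp [h]
  · intro y
    rw [Finset.sum_range]
    have := t.sum_eq_one (mem_univ y)
    rw [finsum_eq_sum_of_fintype] at this
    rw [← this]; refine Finset.sum_congr rfl fun i _ => ?_; simp [Nat.le_of_lt_succ i.2]
  · intro i y
    by_cases h : i < m + 1
    · simp only [h, dif_pos]; exact hs1 _ _
    · simp [h]
  · intro i y hi
    simp [show ¬ i < m + 1 by omega]
  · intro i y0 hy0
    by_cases h : i < m + 1
    · simp only [h, if_true, dif_pos] at hy0 ⊢
      exact hs0 ⟨i, h⟩ y0 hy0
    · simp [h]

theorem TT_contOn {X M : Type*} [TopologicalSpace X] [TopologicalSpace M]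
    [AddCommGroup M] [Module ℝ M] [ContinuousAdd M] [ContinuousSMul ℝ M]
    {s t : ℕ → ℝ} {π : ℕ → ℕ → ℕ → ℕ} {N : ℕ → ℕ} {vv : ℕ → ℕ → M} {P : ℕ → X → ℕ → ℝ}
    (rel : ℕ → Prop) (hrel : ∀ i, ¬ rel i → s i = 0 ∧ t i = 0) {A : Set X}
    (hP : ∀ i l, rel i → ContinuousOn (fun x => P i x l) A) (J : ℕ) :
    ContinuousOn (fun x => TT s t π N vv (fun i => P i x) J) A := by
  induction J with
  | zero => exact continuousOn_const
  | succ J ih =>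
    by_cases hJ : rel J
    · refine (ih.const_smul (1 - s J)).add (continuousOn_finsetSum _ fun l _ => ?_)
      exact (hP J l hJ).smul continuousOn_const
    · obtain ⟨h1, h2⟩ := hrel J hJ
      simpa [TT, h1, h2] using ih

theorem approx {X Y H : Type*} [TopologicalSpace X] [TopologicalSpace Y] [PseudoMetricSpace H]
    [T2Space X] [T2Space Y] [ParacompactSpace X] [ParacompactSpace Y]
    {f : X → Y} (hperf : IsPerfectMap f) {h : X → H} (hh : Continuous h)
    {n m p : ℕ} (hp : 2 * n + m < p)
    (hdim : ∀ y, CovDimLE ↥(f ⁻¹' {y}) n) (hdimY : CovDimLE Y m)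
    (g : C(X, cube p)) (α : C(X, ℝ)) (hα0 : ∀ x, 0 < α x) {ε : ℝ} (hε : 0 < ε) :
    ∃ g' : C(X, cube p), (∀ x, dist (g x) (g' x) ≤ α x) ∧
      ∀ y, LocRep f h ε n m (fun x => (g' x : EuclideanSpace ℝ (Fin p))) y := by
  classical
  obtain ⟨hf, hfc, hfk⟩ := hperf
  obtain ⟨L, hL⟩ := levels_exist ⟨hf, hfc, hfk⟩ hh (g := fun x => (g x : EuclideanSpace ℝ (Fin p)))
    (continuous_subtype_val.comp g.continuous) (fun x => (g x).2) α.continuous hα0 hε hdim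
  obtain ⟨d, F, hF0, hF1, hF2, hGA, hGR, hd⟩ := palettes (n := n) hp
  obtain ⟨G, k, s, t, hkV, hkc, hs, ht, hs0, hs1, ht0, htsum, hst, htm, hz⟩ :=
    layer_data hdimY (fun i => (L i).V) (fun i => (L i).V_open) (fun i => (L i).V_cover)
  have hb : ∀ i κ l, ∃ b, d i (Nat.pair l b) ∈ (L i).Q κ l := fun i κ l =>
    hd i l _ ((L i).Q_open κ l) ((L i).Q_ne κ l)
  choose b hb using hb
  have hρ : ∀ J i k' k l', ∃ l, i < J → ∀ x, f x ∈ (L J).V k' → f x ∈ (L i).V k →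
      0 < (L J).ψ k' l' x → 0 < (L i).ψ k l x := fun J i k' k l' => by
    by_cases hi : i < J
    · obtain ⟨l, hl⟩ := hL i J hi k' k l'
      exact ⟨l, fun _ => hl⟩
    · exact ⟨0, fun h => absurd h hi⟩
  choose ρ hρ using hρ
  let π : ℕ → Y → ℕ → ℕ → ℕ := fun J y l i => ρ J i (k J y) (k i y) l
  let vv : ℕ → Y → ℕ → EuclideanSpace ℝ (Fin p) × ℝ := fun i y l =>
    (d i (Nat.pair l (b i (k i y) l)), 1)
  let N : ℕ → Y → ℕ := fun i y => (L i).N (k i y)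
  let P : ℕ → X → ℕ → ℝ := fun i x l => (L i).ψ (k i (f x)) l x /
    ∑ l' ∈ Finset.range (N i (f x)), (L i).ψ (k i (f x)) l' x
  let T : X → EuclideanSpace ℝ (Fin p) × ℝ := fun x =>
    TT (fun i => s i (f x)) (fun i => t i (f x)) (fun J => π J (f x))
      (fun i => N i (f x)) (fun i => vv i (f x)) (fun i => P i x) (m+1)
  have hrel : ∀ y i, y ∉ G i → s i y = 0 ∧ t i y = 0 := fun y i hy => (hz i y hy).self_of_nhds
  have hden : ∀ i x, f x ∈ G i → 0 < ∑ l' ∈ Finset.range (N i (f x)), (L i).ψ (k i (f x)) l' x := by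
    intro i x hx
    obtain ⟨l, hl⟩ := (L i).pos (k i (f x)) x (subset_closure (hkV i _ hx))
    refine Finset.sum_pos' (fun l _ => (L i).nonneg _ _ _) ⟨l, Finset.mem_range.2 ?_, hl⟩
    by_contra hN
    rw [(L i).zero _ _ _ (not_lt.1 hN)] at hl
    exact lt_irrefl _ hl
  have hP0 : ∀ x i l, f x ∈ G i → 0 ≤ P i x l := fun x i l hx =>
    div_nonneg ((L i).nonneg _ _ _) (hden i x hx).le
  have hPpos : ∀ x i l, f x ∈ G i → P i x l ≠ 0 → 0 < (L i).ψ (k i (f x)) l x := by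
    intro x i l hx hne
    refine lt_of_le_of_ne ((L i).nonneg _ _ _) fun h0 => hne ?_
    simp only [P, ← h0, zero_div]
  have hPsum : ∀ x i, f x ∈ G i → ∑ l ∈ Finset.range (N i (f x)), P i x l = 1 := fun x i hx => by
    simp only [P]
    rw [← Finset.sum_div, div_self (hden i x hx).ne']
  have hππ : ∀ x J l i, i < J → f x ∈ G J → f x ∈ G i → 0 < (L J).ψ (k J (f x)) l x →
      0 < (L i).ψ (k i (f x)) (π J (f x) l i) x := fun x J l i hi hJ hi' hpos =>
    hρ J i _ _ l hi x (hkV J _ hJ) (hkV i _ hi') hpos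
  have hPc : ∀ i x0 l, f x0 ∈ G i → ContinuousAt (fun x => P i x l) x0 := by
    intro i x0 l hx0
    have h1 : ContinuousAt (fun x => (L i).ψ (k i (f x0)) l x /
        ∑ l' ∈ Finset.range (N i (f x0)), (L i).ψ (k i (f x0)) l' x) x0 := by
      refine ContinuousAt.div ((L i).ψ _ l).continuous.continuousAt ?_ (hden i x0 hx0).ne'
      exact (continuous_finsetSum _ fun l' _ => ((L i).ψ _ l').continuous).continuousAt
    refine h1.congr ?_
    filter_upwards [hf.continuousAt.eventually (hkc i _ hx0)] with x hx
    simp only [P, N, hx]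
  have hTc : Continuous T := continuous_iff_continuousAt.2 fun x0 =>
    TT_contAt hf hs ht (G := G) (π := π) (vv := vv) (N := N) (P := P) hz
      (fun i y0 hy0 => by
        filter_upwards [hkc i y0 hy0] with y hy
        simp only [vv, hy])
      (fun i y0 hy0 => by
        filter_upwards [hkc i y0 hy0] with y hy
        simp only [N, hy])
      (fun J i y0 _ hJ hi l => by
        filter_upwards [hkc i y0 hi, hkc J y0 hJ] with y hy hy'
        simp only [π, hy, hy'])
      hPc (m+1) x0
  have hmass : ∀ x, (T x).2 = 1 := by
    intro x
    have h1 := TT_map (s := fun i => s i (f x)) (t := fun i => t i (f x)) (π := fun J => π J (f x))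
      (N := fun i => N i (f x)) (vv := fun i => vv i (f x)) (P := fun i => P i x)
      (LinearMap.snd ℝ (EuclideanSpace ℝ (Fin p)) ℝ) (m+1)
    have h2 := TT_mass (s := fun i => s i (f x)) (t := fun i => t i (f x)) (π := fun J => π J (f x))
      (N := fun i => N i (f x)) (P := fun i => P i x) (fun i => f x ∈ G i) (hrel (f x))
      (hPsum x) (m+1)
    rw [htsum] at h2
    exact h1.trans h2
  have hcone : ∀ x, ‖(T x).1 - (T x).2 • (g x : EuclideanSpace ℝ (Fin p))‖ ≤ (T x).2 * α x ∧
      ∀ i, 0 ≤ (T x).1 i ∧ (T x).1 i ≤ (T x).2 := by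
    intro x
    refine TT_cone (fun w : EuclideanSpace ℝ (Fin p) × ℝ =>
      ‖w.1 - w.2 • (g x : EuclideanSpace ℝ (Fin p))‖ ≤ w.2 * α x ∧
      ∀ i, 0 ≤ w.1 i ∧ w.1 i ≤ w.2) (by simp) ?_ ?_ (fun i => hs0 i _) (fun i => hs1 i _)
      (fun i => ht0 i _) (fun i => f x ∈ G i) (hrel (f x))
      (fun i l => 0 < (L i).ψ (k i (f x)) l x) ?_ (hππ x) (hP0 x) (hPpos x) (m+1)
    · rintro a c ⟨ha, ha'⟩ ⟨hc, hc'⟩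
      refine ⟨?_, fun i => ?_⟩
      · have : (a + c).1 - (a + c).2 • (g x : EuclideanSpace ℝ (Fin p)) =
          (a.1 - a.2 • (g x : EuclideanSpace ℝ (Fin p))) +
          (c.1 - c.2 • (g x : EuclideanSpace ℝ (Fin p))) := by
          simp only [Prod.fst_add, Prod.snd_add]; module
        rw [this]
        refine (norm_add_le _ _).trans ((add_le_add ha hc).trans_eq ?_)
        simp only [Prod.snd_add]; ring
      · have h1 := ha' i
        have h2 := hc' i
        simp only [Prod.fst_add, Prod.snd_add, PiLp.add_apply]
        constructor <;> linarith
    · rintro c a hc ⟨ha, ha'⟩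
      refine ⟨?_, fun i => ?_⟩
      · have : (c • a).1 - (c • a).2 • (g x : EuclideanSpace ℝ (Fin p)) =
          c • (a.1 - a.2 • (g x : EuclideanSpace ℝ (Fin p))) := by
          simp only [Prod.smul_fst, Prod.smul_snd, smul_eq_mul]; module
        rw [this, norm_smul, Real.norm_of_nonneg hc]
        refine (mul_le_mul_of_nonneg_left ha hc).trans_eq ?_
        simp only [Prod.smul_snd, smul_eq_mul]; ring
      · have h1 := ha' i
        simp only [Prod.smul_fst, Prod.smul_snd, PiLp.smul_apply, smul_eq_mul]
        exact ⟨mul_nonneg hc h1.1, mul_le_mul_of_nonneg_left h1.2 hc⟩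
    · intro i l hi hl _
      have hq := hb i (k i (f x)) l
      refine ⟨?_, fun j => ?_⟩
      · have := (L i).Q_close _ _ _ x hq (hkV i _ hi) hl
        simpa [vv, dist_eq_norm] using this
      · exact (L i).Q_sub _ _ hq j
  let g' : C(X, cube p) := ⟨fun x => ⟨(T x).1, fun i => by
    have := (hcone x).2 i
    rw [hmass x] at this
    exact this⟩, Continuous.subtype_mk (continuous_fst.comp hTc) _⟩
  refine ⟨g', fun x => ?_, fun y => ?_⟩
  · have := (hcone x).1
    rw [hmass x, one_smul, one_mul] at this
    rw [Subtype.dist_eq, dist_comm, dist_eq_norm]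
    exact this
  -- top index
  obtain ⟨j, hj, hjmax⟩ : ∃ j, t j y ≠ 0 ∧ ∀ i, j < i → t i y = 0 := by
    have hne : ∃ j ∈ Finset.range (m+1), t j y ≠ 0 := by
      by_contra! hcon
      have := htsum y
      rw [Finset.sum_eq_zero hcon] at this
      exact zero_ne_one this
    let S := (Finset.range (m+1)).filter fun i => t i y ≠ 0
    have hS : S.Nonempty := by
      obtain ⟨j, h1, h2⟩ := hne
      exact ⟨j, Finset.mem_filter.2 ⟨h1, h2⟩⟩
    refine ⟨S.max' hS, (Finset.mem_filter.1 (S.max'_mem hS)).2, fun i hi => ?_⟩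
    by_contra hti
    refine absurd (S.le_max' i (Finset.mem_filter.2 ⟨Finset.mem_range.2 ?_, hti⟩)) (not_le.2 hi)
    by_contra him
    exact hti (htm i y (by omega))
  have hjm : j ≤ m := by
    by_contra hjm
    exact hj (htm j y (by omega))
  have hjG : y ∈ G j := by
    by_contra hjG
    exact hj (hrel y j hjG).2
  have hsj : s j y = 1 := hst j y hj
  have hrel' : ∀ i, y ∉ G i → s i y = 0 ∧ (if i = j then (1:ℝ) else 0) = 0 := fun i hi =>
    ⟨(hrel y i hi).1, if_neg fun h : i = j => hi (h ▸ hjG)⟩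
  let a : X → ℕ →₀ ℝ := fun x => aT (fun i => s i y) (fun J => π J y) (fun i => N i y) j
    (fun i => P i x) (m+1)
  -- representation
  have hΦ : ∀ l, ∃ Φ ∈ F j, DD (fun i => s i y) (fun i => t i y) (fun J => π J y)
      (fun i => vv i y) j (π j y l) =
      t j y • Φ (fun i : Fin m => if t i y = 0 then s i y else t i y / t j y) := fun l =>
    DD_fam hF0 hF1 hF2 (s := fun i => s i y) (t := fun i => t i y)
      (fun i l => Nat.pair l (b i (k i y) l)) hj (fun i => hst i y) j hjm _
  choose Φ hΦF hΦ using hΦ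
  let u : Fin m → ℝ := fun i : Fin m => if t i y = 0 then s i y else t i y / t j y
  let e : ℕ → EuclideanSpace ℝ (Fin p) × ℝ := fun l => t j y • vv j y l +
    DD (fun i => s i y) (fun i => t i y) (fun J => π J y) (fun i => vv i y) j (π j y l)
  have he : ∀ l, e l = t j y • ((d j (Nat.pair l (b j (k j y) l)), (1:ℝ)) + Φ l u) := fun l => by
    simp only [e, hΦ, vv, u, smul_add]
  have hT : ∀ x, f x = y → T x = Finsupp.linearCombination ℝ e (a x) := by
    rintro x rfl
    exact TT_lc (s := fun i => s i (f x)) (t := fun i => t i (f x)) hsj hjmax (m+1) (by omega)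
  have hacone : ∀ x, f x = y → ∀ l, 0 ≤ a x l ∧ (a x l ≠ 0 → 0 < (L j).ψ (k j y) l x) := by
    rintro x rfl
    have := TT_cone (M := ℕ →₀ ℝ) (s := fun i => s i (f x)) (t := fun i => if i = j then (1:ℝ) else 0)
      (π := fun J => π J (f x)) (N := fun i => N i (f x)) (P := fun i => P i x)
      (vv := fun _ l => Finsupp.single l 1)
      (fun w => ∀ l, 0 ≤ w l ∧ (w l ≠ 0 → 0 < (L j).ψ (k j (f x)) l x)) (by simp) ?_ ?_
      (fun i => hs0 i _) (fun i => hs1 i _)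
      (fun i => by split_ifs <;> norm_num) (fun i => f x ∈ G i) hrel'
      (fun i l => 0 < (L i).ψ (k i (f x)) l x) ?_ (hππ x) (hP0 x) (hPpos x) (m+1)
    · exact this
    · intro w w' hw hw' l
      refine ⟨add_nonneg (hw l).1 (hw' l).1, fun hne => ?_⟩
      by_cases h0 : w l = 0
      · refine (hw' l).2 fun h0' => hne ?_
        simp [h0, h0']
      · exact (hw l).2 h0
    · intro c w hc hw l
      refine ⟨mul_nonneg hc (hw l).1, fun hne => (hw l).2 fun h0 => hne ?_⟩
      simp [h0]
    · intro i l hi hl hne l'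
      have hij : i = j := by
        by_contra hij
        exact hne (if_neg hij)
      subst hij
      by_cases hll : l' = l
      · subst hll
        simp [hl]
      · simp [hll]
  have hasum : ∀ x, f x = y → Finsupp.lsum ℝ (fun _ : ℕ => (LinearMap.id : ℝ →ₗ[ℝ] ℝ)) (a x) = 1 := by
    rintro x rfl
    have h1 := TT_map (s := fun i => s i (f x)) (t := fun i => if i = j then (1:ℝ) else 0)
      (π := fun J => π J (f x)) (N := fun i => N i (f x)) (P := fun i => P i x)
      (vv := fun _ l => Finsupp.single l (1:ℝ))
      (Finsupp.lsum ℝ (fun _ : ℕ => (LinearMap.id : ℝ →ₗ[ℝ] ℝ))) (m+1)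
    have h2 := TT_mass (s := fun i => s i (f x)) (t := fun i => if i = j then (1:ℝ) else 0)
      (π := fun J => π J (f x))
      (N := fun i => N i (f x)) (P := fun i => P i x) (fun i => f x ∈ G i) hrel'
      (hPsum x) (m+1)
    have h3 : ∑ i ∈ Finset.range (m+1), (if i = j then (1:ℝ) else 0) = 1 := by
      rw [Finset.sum_ite_eq' (Finset.range (m+1)) j]; simp [hjm]
    rw [h3] at h2
    simp only [Finsupp.lsum_single, LinearMap.id_apply] at h1
    exact h1.trans h2
  have hcard : ∀ x, f x = y → (a x).support.card ≤ n + 1 := by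
    intro x hx
    refine le_trans ?_ ((L j).order (k j y) x (by rw [hx]; exact subset_closure (hkV j y hjG)))
    rw [← ncard_coe_finset]
    refine ncard_le_ncard (fun l hl => (hacone x hx l).2 (by simpa using hl)) ?_
    refine (Finset.finite_toSet (Finset.range ((L j).N (k j y)))).subset fun l hl => ?_
    simp only [Finset.coe_range, mem_Iio]
    by_contra hN
    have hl' : 0 < (L j).ψ (k j y) l x := hl
    rw [(L j).zero _ _ _ (not_lt.1 hN)] at hl'
    exact lt_irrefl _ hl'
  have hane : ∀ x, f x = y → a x ≠ 0 := fun x hx h0 => by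
    have := hasum x hx
    rw [h0, map_zero] at this
    exact zero_ne_one this
  refine ⟨fun l => f ⁻¹' ((L j).V (k j y)) ∩ {x | 0 < (L j).ψ (k j y) l x}, N j y, a, ?_, ?_, ?_, ?_, ?_⟩
  · exact fun l => (((L j).V_open _).preimage hf).inter
      (isOpen_lt continuous_const ((L j).ψ _ l).continuous)
  · rintro l x ⟨hx1, hx2⟩ x' ⟨hx1', hx2'⟩
    exact (L j).small _ _ _ _ hx1 hx1' hx2 hx2'
  · intro x hx
    refine ⟨fun l => (hacone x hx l).1, fun l hl => ⟨⟨?_, (hacone x hx l).2 hl⟩, ?_⟩, hane x hx,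
      hcard x hx, fun σ r hr => ?_⟩
    · rw [mem_preimage, hx]; exact hkV j y hjG
    · by_contra hN
      have hl' := (hacone x hx l).2 hl
      rw [(L j).zero _ _ _ (not_lt.1 hN)] at hl'
      exact lt_irrefl _ hl'
    · by_contra hcon
      refine hane x hx (gp_R (hGR j) hΦF hj u (fun l => b j (k j y) l) he (a x) σ r (not_lt.1 hcon)
        fun i hi => ?_)
      rw [← hT x hx, hmass, one_mul]
      exact hr i hi
  · intro l
    have h1 : ∀ x, a x l = TT (fun i => s i y) (fun i => if i = j then (1:ℝ) else 0)
      (fun J => π J y) (fun i => N i y) (fun _ l' => Finsupp.lapply (R := ℝ) l (Finsupp.single l' (1:ℝ)))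
      (fun i => P i x) (m+1) := fun x => TT_map (Finsupp.lapply (R := ℝ) l) (m+1)
    simp only [h1]
    refine TT_contOn (fun i => y ∈ G i) hrel' (fun i l hi x hx => ?_) (m+1)
    have hx' : f x = y := hx
    exact (hPc i x l (hx' ▸ hi)).continuousWithinAt
  · intro x x' hx hx' hg
    refine sub_eq_zero.1 (gp_A (hGA j) hΦF hj u (fun l => b j (k j y) l) he (a x - a x') ?_ ?_ ?_)
    · refine (Finset.card_le_card Finsupp.support_sub).trans ((Finset.card_union_le _ _).trans ?_)
      have := hcard x hx
      have := hcard x' hx'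
      omega
    · have : Finsupp.lsum ℝ (fun _ : ℕ => (LinearMap.id : ℝ →ₗ[ℝ] ℝ)) (a x - a x') = 0 := by
        rw [map_sub, hasum x hx, hasum x' hx', sub_self]
      rw [Finsupp.lsum_apply] at this
      exact this
    · rw [map_sub, ← hT x hx, ← hT x' hx', Prod.fst_sub, sub_eq_zero]
      exact hg

theorem local_to_alpha {Y : Type*} [TopologicalSpace Y] [T2Space Y] [ParacompactSpace Y]
    (Q : Y → ℝ → Prop) (hmono : ∀ y a b, 0 < a → a ≤ b → Q y b → Q y a)
    (hloc : ∀ y0, ∃ δ > 0, ∀ᶠ y in 𝓝 y0, Q y δ) :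
    ∃ α : C(Y, ℝ), ∀ y, 0 < α y ∧ Q y (α y) := by
  refine exists_continuous_forall_mem_convex_of_local_const (t := fun y => {δ | 0 < δ ∧ Q y δ})
    (fun y => ?_) (fun y0 => ?_)
  · refine OrdConnected.convex ⟨?_⟩
    rintro a ha b hb c ⟨hc1, hc2⟩
    have hc0 : 0 < c := lt_of_lt_of_le ha.1 hc1
    exact ⟨hc0, hmono y c b hc0 hc2 hb.2⟩
  · obtain ⟨δ, hδ, h⟩ := hloc y0
    exact ⟨δ, h.mono fun y hy => ⟨hδ, hy⟩⟩

theorem directed_nat {Z : Type*} (D : ℝ → Set Z) (hD : ∀ a b, a ≤ b → D b ⊆ D a) :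
    Directed (· ⊆ ·) (fun k : ℕ => D (1 / ((k:ℝ) + 1))) := by
  intro i j
  exact ⟨max i j, hD _ _ (Nat.one_div_le_one_div (le_max_left i j)),
    hD _ _ (Nat.one_div_le_one_div (le_max_right i j))⟩

theorem open_A {X Y H : Type*} [TopologicalSpace X] [TopologicalSpace Y] [PseudoMetricSpace H]
    [T2Space Y] [ParacompactSpace Y]
    {f : X → Y} (hperf : IsPerfectMap f) {h : X → H} (hh : Continuous h) (ε : ℝ)
    {M : Type*} [MetricSpace M] : SLOpen {g : C(X, M) | GoodA f h ε g} := by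
  obtain ⟨hf, hfc, hfk⟩ := hperf
  intro g hg
  obtain ⟨α, hα⟩ := local_to_alpha (fun y δ => ∀ x x', f x = y → f x' = y → ε ≤ dist (h x) (h x') →
    2 * δ < dist (g x) (g x')) (fun y a b _ hab hb x x' h1 h2 h3 => by
      have := hb x x' h1 h2 h3
      linarith) (fun y0 => by
    let D : ℝ → Set (X × X) := fun δ => {z | dist (h z.1) (h z.2) < ε} ∪
      {z | 2 * δ < dist (g z.1) (g z.2)}
    have hDo : ∀ δ, IsOpen (D δ) := fun δ =>
      (isOpen_lt (by fun_prop) continuous_const).union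
        (isOpen_lt continuous_const (by fun_prop))
    obtain ⟨k, hk⟩ := ((hfk y0).prod (hfk y0)).elim_directed_cover
      (fun k : ℕ => D (1 / ((k:ℝ) + 1))) (fun k => hDo _) (by
        rintro ⟨x, x'⟩ ⟨hx, hx'⟩
        by_cases hd : dist (h x) (h x') < ε
        · exact mem_iUnion.2 ⟨0, Or.inl hd⟩
        · have hx1 : f x = y0 := hx
          have hx2 : f x' = y0 := hx'
          have := dist_pos.2 (hg x x' (hx1.trans hx2.symm) (not_lt.1 hd))
          obtain ⟨k, hk⟩ := exists_nat_one_div_lt (half_pos this)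
          refine mem_iUnion.2 ⟨k, Or.inr ?_⟩
          show 2 * (1 / ((k:ℝ) + 1)) < dist (g x) (g x')
          linarith)
      (directed_nat D fun a b hab z hz => hz.imp id fun (hz : 2 * b < dist (g z.1) (g z.2)) => by
        show 2 * a < _
        linarith)
    obtain ⟨U, U', hU, hU', h1, h1', h2⟩ := generalized_tube_lemma (hfk y0) (hfk y0) (hDo _) hk
    obtain ⟨V, hV, hy, hVU⟩ := tube_open hfc (hU.inter hU') (subset_inter h1 h1')
    refine ⟨1 / ((k:ℝ) + 1), by positivity, ?_⟩
    filter_upwards [hV.mem_nhds hy] with y hyV x x' hx hx' hd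
    have e1 := hVU (show f x ∈ V from hx ▸ hyV)
    have e2 := hVU (show f x' ∈ V from hx' ▸ hyV)
    rcases h2 (show (x, x') ∈ U ×ˢ U' from ⟨e1.1, e2.2⟩) with h3 | h3
    · exact absurd (show dist (h x) (h x') < ε from h3) (not_lt.2 hd)
    · exact h3)
  refine ⟨α.comp ⟨f, hf⟩, fun x => (hα _).1, fun g' hg' x x' hxx hd he => ?_⟩
  have h1 := (hα (f x)).2 x x' rfl hxx.symm hd
  have h2 : dist (g x) (g' x) ≤ α (f x) := hg' x
  have h3 : dist (g x') (g' x') ≤ α (f x') := hg' x'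
  rw [← hxx, ← he] at h3
  have h4 := dist_triangle_right (g x) (g x') (g' x)
  linarith

theorem open_R {X Y H : Type*} [TopologicalSpace X] [TopologicalSpace Y] [PseudoMetricSpace H]
    [T2Space Y] [ParacompactSpace Y]
    {f : X → Y} (hperf : IsPerfectMap f) {h : X → H} (ε : ℝ) {p : ℕ}
    (s : Finset (Fin p)) (r : Fin p → ℚ) (d : ℕ) :
    SLOpen {g : C(X, cube p) | GoodR f h ε s r d fun x => (g x : EuclideanSpace ℝ (Fin p))} := by
  obtain ⟨hf, hfc, hfk⟩ := hperf
  intro g hg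
  have hgi : ∀ i, Continuous fun x => (g x : EuclideanSpace ℝ (Fin p)) i := fun i => by fun_prop
  obtain ⟨α, hα⟩ := local_to_alpha (fun y δ => ∃ (ι : Type) (_ : Finite ι) (O : ι → Set X),
      (∀ i, IsOpen (O i)) ∧
      (∀ i, ∀ x ∈ O i, ∀ x' ∈ O i, dist (h x) (h x') < ε) ∧ (∀ x, {i | x ∈ O i}.ncard ≤ d) ∧
      ∀ x, f x = y → (∀ i ∈ s, |(g x : EuclideanSpace ℝ (Fin p)) i - (r i : ℝ)| ≤ δ) → ∃ i, x ∈ O i)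
    (by
      rintro y a b _ hab ⟨ι, hι, O, h1, h2, h3, h4⟩
      exact ⟨ι, hι, O, h1, h2, h3, fun x hx hi => h4 x hx fun i his => (hi i his).trans hab⟩)
    (by
      intro y0
      obtain ⟨ι, hι, O, h1, h2, h3, h4⟩ := hg y0
      let D : ℝ → Set X := fun δ => (⋃ i, O i) ∪
        ⋃ i ∈ s, {x | δ < |(g x : EuclideanSpace ℝ (Fin p)) i - (r i : ℝ)|}
      have hDo : ∀ δ, IsOpen (D δ) := fun δ => (isOpen_iUnion h1).union
        (isOpen_biUnion fun i _ => isOpen_lt continuous_const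
          (((hgi i).sub continuous_const).abs))
      obtain ⟨k, hk⟩ := (hfk y0).elim_directed_cover
        (fun k : ℕ => D (1 / ((k:ℝ) + 1))) (fun k => hDo _) (by
          intro x hx
          by_cases hd : ∀ i ∈ s, (g x : EuclideanSpace ℝ (Fin p)) i = (r i : ℝ)
          · exact mem_iUnion.2 ⟨0, Or.inl (mem_iUnion.2 (h4 x hx hd))⟩
          · push Not at hd
            obtain ⟨i, his, hi⟩ := hd
            obtain ⟨k, hk⟩ := exists_nat_one_div_lt (abs_pos.2 (sub_ne_zero.2 hi))
            exact mem_iUnion.2 ⟨k, Or.inr (mem_iUnion₂.2 ⟨i, his, hk⟩)⟩)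
        (directed_nat D fun a b hab z hz => hz.imp id fun hz => by
          obtain ⟨i, his, hi⟩ := mem_iUnion₂.1 hz
          exact mem_iUnion₂.2 ⟨i, his, lt_of_le_of_lt hab hi⟩)
      obtain ⟨V, hV, hy, hVU⟩ := tube_open hfc (hDo _) hk
      refine ⟨1 / ((k:ℝ) + 1), by positivity, ?_⟩
      filter_upwards [hV.mem_nhds hy] with y hyV
      refine ⟨ι, hι, O, h1, h2, h3, fun x hx hi => ?_⟩
      rcases hVU (show f x ∈ V from hx ▸ hyV) with h5 | h5
      · exact mem_iUnion.1 h5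
      · obtain ⟨i, his, h6⟩ := mem_iUnion₂.1 h5
        exact absurd (hi i his) (not_le.2 h6))
  refine ⟨α.comp ⟨f, hf⟩, fun x => (hα _).1, fun g' hg' y => ?_⟩
  obtain ⟨ι, hι, O, h1, h2, h3, h4⟩ := (hα y).2
  refine ⟨ι, hι, O, h1, h2, h3, fun x hx hi => h4 x hx fun i his => ?_⟩
  have h5 : dist (g x) (g' x) ≤ α (f x) := hg' x
  rw [hx, Subtype.dist_eq, dist_eq_norm] at h5
  rw [← hi i his]
  exact (PiLp.norm_apply_le ((g x : EuclideanSpace ℝ (Fin p)) -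
    (g' x : EuclideanSpace ℝ (Fin p))) i).trans h5

theorem isClosed_cube (p : ℕ) : IsClosed (cube p) := by
  have : cube p = ⋂ i, {x | x i ∈ Set.Icc (0:ℝ) 1} := by
    ext x; simp [cube]
  rw [this]
  exact isClosed_iInter fun i => isClosed_Icc.preimage (by fun_prop)

theorem embed_of {X Y H : Type*} [TopologicalSpace X] [TopologicalSpace Y] [MetricSpace H]
    [T2Space Y] {f : X → Y} (hperf : IsPerfectMap f) {h : X → H}
    (hinj : ∀ x x', f x = f x' → h x = h x' → x = x')
    {M : Type*} [MetricSpace M] (g : C(X, M)) (hg : ∀ k : ℕ, GoodA f h (1 / ((k:ℝ) + 1)) g) :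
    Function.Injective (fun x => (f x, g x)) ∧ IsEmbedding (fun x => (f x, g x)) := by
  have hi : Function.Injective (fun x => (f x, g x)) := by
    intro x x' he
    have h1 : f x = f x' := (Prod.ext_iff.1 he).1
    have h2 : g x = g x' := (Prod.ext_iff.1 he).2
    refine hinj x x' h1 ?_
    by_contra hne
    obtain ⟨k, hk⟩ := exists_nat_one_div_lt (dist_pos.2 hne)
    exact hg k x x' h1 hk.le h2
  refine ⟨hi, ?_⟩
  have hp : IsProperMap f := isProperMap_iff_isClosedMap_and_compact_fibers.2 hperf
  have hc : Continuous (fun x => (f x, g x)) := hperf.1.prodMk g.continuous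
  have hp' : IsProperMap (fun x => (f x, g x)) := isProperMap_of_comp_of_t2 hc continuous_fst hp
  exact (IsClosedEmbedding.of_continuous_injective_isClosedMap hc hi hp'.isClosedMap).isEmbedding

theorem dim_of {X Y H : Type*} [TopologicalSpace X] [TopologicalSpace Y] [MetricSpace H]
    [T2Space X] [T2Space Y] {f : X → Y} (hperf : IsPerfectMap f) {h : X → H} (hh : Continuous h)
    (hinj : ∀ x x', f x = f x' → h x = h x' → x = x') {p : ℕ}
    {g : X → EuclideanSpace ℝ (Fin p)} (hgc : Continuous g)
    (hgi : ∀ x x', f x = f x' → g x = g x' → x = x')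
    (s : Finset (Fin p)) (r : Fin p → ℚ) (d : ℕ)
    (hg : ∀ k : ℕ, GoodR f h (1 / ((k:ℝ) + 1)) s r d g) (y : Y) (D : ℤ)
    (hD : 1 ≤ d → (d : ℤ) ≤ D + 1) :
    CovDimLE ↥((g '' (f ⁻¹' {y})) ∩ {x | ∀ i ∈ s, x i = (r i : ℝ)}) D := by
  classical
  obtain ⟨hf, hfc, hfk⟩ := hperf
  let K : Set X := f ⁻¹' {y} ∩ {x | ∀ i ∈ s, g x i = (r i : ℝ)}
  have hPcl : IsClosed {x : EuclideanSpace ℝ (Fin p) | ∀ i ∈ s, x i = (r i : ℝ)} := by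
    have : {x : EuclideanSpace ℝ (Fin p) | ∀ i ∈ s, x i = (r i : ℝ)} =
        ⋂ i ∈ s, {x | x i = (r i : ℝ)} := by ext x; simp
    rw [this]
    exact isClosed_biInter fun i _ => isClosed_eq (by fun_prop) continuous_const
  have hK : IsCompact K := (hfk y).inter_right (hPcl.preimage hgc)
  have : CompactSpace K := isCompact_iff_compactSpace.1 hK
  let γ : K → ↥((g '' (f ⁻¹' {y})) ∩ {x | ∀ i ∈ s, x i = (r i : ℝ)}) := fun x =>
    ⟨g x, mem_image_of_mem g x.2.1, x.2.2⟩
  have hγc : Continuous γ := (hgc.comp continuous_subtype_val).subtype_mk _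
  have hγ : Function.Bijective γ := by
    constructor
    · rintro ⟨x, hx⟩ ⟨x', hx'⟩ he
      have e1 : f x = y := hx.1
      have e2 : f x' = y := hx'.1
      exact Subtype.ext (hgi x x' (e1.trans e2.symm) (congrArg Subtype.val he))
    · rintro ⟨_, ⟨x, hx, rfl⟩, hz⟩
      exact ⟨⟨x, hx, hz⟩, rfl⟩
  let Γ : K ≃ₜ ↥((g '' (f ⁻¹' {y})) ∩ {x | ∀ i ∈ s, x i = (r i : ℝ)}) :=
    Continuous.homeoOfEquivCompactToT2 (f := Equiv.ofBijective γ hγ) hγc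
  have : CompactSpace ↥((g '' (f ⁻¹' {y})) ∩ {x | ∀ i ∈ s, x i = (r i : ℝ)}) := Γ.compactSpace
  intro ι U hι hUo hUc
  let σ := Γ.symm
  let q : ↥((g '' (f ⁻¹' {y})) ∩ {x | ∀ i ∈ s, x i = (r i : ℝ)}) → H := fun z => h (σ z)
  have hqc : Continuous q := hh.comp (continuous_subtype_val.comp σ.continuous)
  have hqi : Function.Injective q := by
    intro z z' he
    have e1 : f (σ z) = y := (σ z).2.1
    have e2 : f (σ z') = y := (σ z').2.1
    exact σ.injective (Subtype.ext (hinj _ _ (e1.trans e2.symm) he))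
  have hqe := hqc.isClosedEmbedding hqi
  have hU' : ∀ i, ∃ U', IsOpen U' ∧ q ⁻¹' U' = U i := fun i =>
    hqe.isEmbedding.isInducing.isOpen_iff.1 (hUo i)
  choose U' hU'o hU' using hU'
  obtain ⟨δ, hδ, hL⟩ := lebesgue_number_lemma_of_metric (isCompact_range hqc) hU'o (by
    rintro _ ⟨z, rfl⟩
    obtain ⟨i, hi⟩ := mem_iUnion.1 (hUc ▸ mem_univ z)
    rw [← hU' i] at hi
    exact mem_iUnion.2 ⟨i, hi⟩)
  obtain ⟨k, hk⟩ := exists_nat_one_div_lt hδ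
  obtain ⟨A, hA, O, hO1, hO2, hO3, hO4⟩ := hg k y
  let W : A → Set ↥((g '' (f ⁻¹' {y})) ∩ {x | ∀ i ∈ s, x i = (r i : ℝ)}) := fun a =>
    {z | (σ z : X) ∈ O a}
  have hWo : ∀ a, IsOpen (W a) := fun a =>
    (hO1 a).preimage (continuous_subtype_val.comp σ.continuous)
  have hc : ∀ a : {a // (W a).Nonempty}, ∃ i, W a ⊆ U i := by
    rintro ⟨a, z, hz⟩
    obtain ⟨i, hi⟩ := hL (q z) (mem_range_self z)
    refine ⟨i, fun z' hz' => ?_⟩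
    rw [← hU' i]
    exact hi ((hO2 a _ hz' _ hz).trans hk)
  choose c hc using hc
  have hcov : ∀ z, ∃ a : {a // (W a).Nonempty}, z ∈ W a := fun z => by
    obtain ⟨a, ha⟩ := hO4 (σ z) (σ z).2.1 (σ z).2.2
    exact ⟨⟨a, z, ha⟩, ha⟩
  refine ⟨fun i => ⋃ a : {a : {a // (W a).Nonempty} // c a = i}, W a.1, fun i =>
    isOpen_iUnion fun a => hWo _, fun i => ?_, ?_, fun z => ?_⟩
  · refine iUnion_subset ?_
    rintro ⟨a, rfl⟩
    exact hc a
  · refine eq_univ_of_forall fun z => ?_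
    obtain ⟨a, ha⟩ := hcov z
    exact mem_iUnion.2 ⟨c a, mem_iUnion.2 ⟨⟨a, rfl⟩, ha⟩⟩
  · have hle : {i | z ∈ ⋃ a : {a : {a // (W a).Nonempty} // c a = i}, W a.1}.ncard ≤ d := by
      have hsub : {i | z ∈ ⋃ a : {a : {a // (W a).Nonempty} // c a = i}, W a.1} ⊆
          c '' {a | z ∈ W a} := by
        intro i hi
        obtain ⟨⟨a, rfl⟩, ha⟩ := mem_iUnion.1 hi
        exact ⟨a, ha, rfl⟩
      calc _ ≤ (c '' {a | z ∈ W a}).ncard := ncard_le_ncard hsub (toFinite _)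
        _ ≤ {a : {a // (W a).Nonempty} | z ∈ W a}.ncard := ncard_image_le (toFinite _)
        _ = (Subtype.val '' {a : {a // (W a).Nonempty} | z ∈ W a}).ncard :=
          (ncard_image_of_injective _ Subtype.val_injective).symm
        _ ≤ {a | (σ z : X) ∈ O a}.ncard := by
          refine ncard_le_ncard ?_ (toFinite _)
          rintro _ ⟨a, ha, rfl⟩
          exact ha
        _ ≤ d := hO3 _
    have hpos : 1 ≤ d := by
      refine le_trans ?_ (hO3 (σ z))
      obtain ⟨a, ha⟩ := hcov z
      exact (ncard_pos (toFinite _)).2 ⟨a.1, ha⟩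
    exact le_trans (by exact_mod_cast hle) (hD hpos)

/-- Corollary 1.2 / Proposition 4.3. Under the hypotheses of Theorem 1.1(i),
there is a dense `G_δ`-set `B` in `C(X, I^{2n+1+m})` with the source limitation topology such that
every `g ∈ B` makes `f × g` an embedding and satisfies condition (R). -/
theorem stmt2 {X Y : Type*} [TopologicalSpace X] [TopologicalSpace Y]
    [T2Space X] [T2Space Y] [ParacompactSpace X] [ParacompactSpace Y]
    (n m : ℕ) (f : X → Y) (hperf : IsPerfectMap f) (hsurj : Function.Surjective f)
    (hw : HasCountableFunctionalWeight f)
    (hdimf : ∀ y : Y, CovDimLE ↥(f ⁻¹' {y}) n)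
    (hdimY : CovDimLE Y m) :
    ∃ B : Set C(X, ↥(cube (2*n+1+m))), SLDense B ∧ SLGdelta B ∧
      ∀ g ∈ B, IsEmbedding (fun x => (f x, g x) : X → Y × ↥(cube (2*n+1+m))) ∧
        ConditionR f n m (fun x => g x) := by
  classical
  obtain ⟨h, hh⟩ := hw
  have hinj : ∀ x x', f x = f x' → h x = h x' → x = x' := fun x x' h1 h2 =>
    hh.injective (Prod.ext h1 h2)
  have : CompleteSpace (cube (2*n+1+m)) := (isClosed_cube _).completeSpace_coe
  let I := ℕ × Option ({s : Finset (Fin (2*n+1+m)) // m + 1 ≤ s.card} × (Fin (2*n+1+m) → ℚ))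
  let F : I → Set C(X, ↥(cube (2*n+1+m))) := fun i => match i with
    | (k, none) => {g | GoodA f h (1 / ((k:ℝ) + 1)) g}
    | (k, some (s, r)) => {g | GoodR f h (1 / ((k:ℝ) + 1)) s.1 r (n + m + 1 - s.1.card)
        fun x => (g x : EuclideanSpace ℝ (Fin (2*n+1+m)))}
  have hFo : ∀ i, SLOpen (F i) := by
    rintro ⟨k, _ | ⟨s, r⟩⟩
    · exact open_A hperf h.continuous _
    · exact open_R hperf _ _ _ _
  have hFd : ∀ i, BallDense (F i) := by
    intro i g α hα
    have hk : (0:ℝ) < 1 / ((i.1:ℝ) + 1) := by positivity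
    obtain ⟨g', hg', hl⟩ := approx hperf h.continuous (n := n) (m := m) (by omega) hdimf hdimY
      g α hα hk
    refine ⟨g', ?_, hg'⟩
    rcases i with ⟨k, _ | ⟨s, r⟩⟩
    · exact fun x x' h1 h2 h3 => goodA_of hl x x' h1 h2 (congrArg Subtype.val h3)
    · exact goodR_of hperf.1 hl s.1 r s.2
  have : Nonempty I := ⟨(0, none)⟩
  obtain ⟨e, he⟩ := exists_surjective_nat I
  refine ⟨⋂ i, F (e i), baire_SL _ (fun i => hFo _) (fun i => hFd _), ⟨_, fun i => hFo _, rfl⟩, ?_⟩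
  intro g hg
  have hgF : ∀ i, g ∈ F i := fun i => by
    obtain ⟨k, rfl⟩ := he i
    exact mem_iInter.1 hg k
  obtain ⟨hgi, hemb⟩ := embed_of hperf hinj g (fun k => hgF (k, none))
  refine ⟨hemb, ?_⟩
  rintro y k hk P ⟨s, r, hs, rfl⟩
  refine dim_of hperf h.continuous hinj (continuous_subtype_val.comp g.continuous)
    (fun x x' h1 h2 => hgi (Prod.ext h1 (Subtype.ext h2))) s r (n + m + 1 - s.card)
    (fun k => hgF (k, some (⟨s, by omega⟩, r))) y _ (fun h1 => by omega)
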